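/- arXiv:1410.7150 — 6 statements merged into one kernel-verified Lean document; each statement's English description precedes it below -/
import Mathlib

section
/- Let p ≥ 3 be an integer and let H be a numerical semigroup with p ∈ H and H ≠ ℕ. Suppose the p−1 nonzero elements of the Apéry set Ap(H,p) can be enumerated as h_1, …, h_{p−1} in such a way that h_i + h_{p−2−i} = h_{p−2} for i = 1, …, p−3 and 2·h_{p−1} = h_{p−2} + p. Then H is pseudo-symmetric. -/
/-- A numerical semigroup: a submonoid of (ℕ,+) with finite complement. -/
def IsNumericalSemigroup (H : Set ℕ) : Prop :=
  0 ∈ H ∧ (∀ a ∈ H, ∀ b ∈ H, a + b ∈ H) ∧ Hᶜ.Finite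

/-- The genus: number of gaps. -/
noncomputable def genus (H : Set ℕ) : ℕ := Hᶜ.ncard

/-- The Frobenius number, as an integer (so that F(ℕ) = -1). -/
noncomputable def frobNum (H : Set ℕ) : ℤ :=
  sSup (insert (-1) ((fun n : ℕ => (n : ℤ)) '' Hᶜ))

/-- The Apéry set of `H` with respect to `p`: elements `h ∈ H` such that `h - p ∉ H`. -/
def aperySet (H : Set ℕ) (p : ℕ) : Set ℕ :=
  {h ∈ H | ∀ k, k + p = h → k ∉ H}

/-- Every gap of a numerical semigroup lies a positive multiple of `p` below a nonzero element
of the Apéry set. -/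
theorem IsNumericalSemigroup.exists_add_mul_mem_aperySet {H : Set ℕ}
    (hH : IsNumericalSemigroup H) {p : ℕ} (hp : 0 < p) {n : ℕ} (hn : n ∉ H) :
    ∃ k, n + (k + 1) * p ∈ aperySet H p \ {0} := by
  classical
  have hex : ∃ k, n + k * p ∈ H := by
    obtain ⟨B, hB⟩ := hH.2.2.bddAbove
    refine ⟨B + 1, by_contra fun hmem => ?_⟩
    have hle : n + (B + 1) * p ≤ B := hB hmem
    nlinarith
  obtain ⟨k, hk⟩ : ∃ k, Nat.find hex = k + 1 := by
    refine Nat.exists_eq_succ_of_ne_zero fun h0 => hn ?_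
    simpa [h0] using Nat.find_spec hex
  have hpos : 0 < (k + 1) * p := by positivity
  refine ⟨k, ⟨by simpa [hk] using Nat.find_spec hex, fun m hm hmH => ?_⟩, by
    simp only [Set.mem_singleton_iff]; omega⟩
  have hmk : m = n + k * p := by
    rw [add_mul] at hm
    omega
  exact Nat.find_min hex (m := k) (by omega) (hmk ▸ hmH)

/-- The Frobenius number is the largest gap. -/
theorem frobNum_eq_of_isGreatest {H : Set ℕ} {F : ℕ} (hF : IsGreatest Hᶜ F) :
    frobNum H = F := by
  refine IsGreatest.csSup_eq ⟨Set.mem_insert_of_mem _ ⟨F, hF.1, rfl⟩, ?_⟩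
  rintro _ (rfl | ⟨n, hn, rfl⟩)
  · omega
  · exact Int.ofNat_le.2 (hF.2 hn)

/-- If `F = 2 * c` is the largest gap of `H` and `x ↦ F - x` maps every gap other than `c` into
`H`, then `H` has exactly `F / 2 + 1` gaps. -/
theorem two_mul_genus_of_isGreatest {H : Set ℕ} (hadd : ∀ a ∈ H, ∀ b ∈ H, a + b ∈ H) {F c : ℕ}
    (hF : IsGreatest Hᶜ F) (hFc : 2 * c = F) (hc : c ∉ H)
    (hsymm : ∀ x ∉ H, x ≠ c → F - x ∈ H) : 2 * genus H = F + 2 := by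
  classical
  have hle : ∀ x, x ∉ H → x ≤ F := fun x hx => hF.2 hx
  set G := (Finset.range (F + 1)).filter (· ∉ H) with hG
  set S := (Finset.range (F + 1)).filter (· ∈ H) with hS
  have hgenus : genus H = G.card := by
    rw [genus, ← Set.ncard_coe_finset]
    congr 1
    ext x
    simp only [hG, Set.mem_compl_iff, Finset.coe_filter, Finset.mem_range, Set.mem_ofPred_eq]
    exact ⟨fun hx => ⟨by have := hle x hx; omega, hx⟩, fun hx => hx.2⟩
  have hsum : S.card + G.card = F + 1 := by
    rw [hS, hG, Finset.card_filter_add_card_filter_not, Finset.card_range]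
  have hcard : (G.erase c).card = S.card := by
    refine Finset.card_nbij' (F - ·) (F - ·) ?_ ?_ ?_ ?_
    · intro x hx
      simp only [hG, Finset.coe_erase, Finset.coe_filter, Finset.mem_range, Set.mem_sdiff,
        Set.mem_ofPred_eq, Set.mem_singleton_iff] at hx
      simp only [hS, Finset.coe_filter, Finset.mem_range, Set.mem_ofPred_eq]
      exact ⟨by omega, hsymm x hx.1.2 hx.2⟩
    · intro x hx
      simp only [hS, Finset.coe_filter, Finset.mem_range, Set.mem_ofPred_eq] at hx
      simp only [hG, Finset.coe_erase, Finset.coe_filter, Finset.mem_range, Set.mem_sdiff,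
        Set.mem_ofPred_eq, Set.mem_singleton_iff]
      refine ⟨⟨by omega, fun hFx => hF.1 ?_⟩, fun hxc => hc ?_⟩
      · have := hadd _ hx.2 _ hFx
        rwa [show x + (F - x) = F by omega] at this
      · rw [show c = x by omega]
        exact hx.2
    · intro x hx
      simp only [hG, Finset.coe_erase, Finset.coe_filter, Finset.mem_range, Set.mem_sdiff,
        Set.mem_ofPred_eq] at hx
      simp only
      omega
    · intro x hx
      simp only [hS, Finset.coe_filter, Finset.mem_range, Set.mem_ofPred_eq] at hx
      simp only
      omega
  have hcG : c ∈ G := by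
    simp only [hG, Finset.mem_filter, Finset.mem_range]
    exact ⟨by omega, hc⟩
  have := Finset.card_erase_add_one hcG
  omega

/-- If the nonzero Apéry elements of `H` with respect to `p` can be enumerated as
`h 1, …, h (p-1)` with `h i + h (p-2-i) = h (p-2)` for `i = 1, …, p-3` and
`2 * h (p-1) = h (p-2) + p`, then `H` is pseudo-symmetric, i.e. `2 g(H) = F(H) + 2`. -/
theorem pseudoSymmetric_of_apery_relations
    (p : ℕ) (hp : 3 ≤ p) (H : Set ℕ) (hH : IsNumericalSemigroup H)
    (hpH : p ∈ H) (hne : H ≠ Set.univ) (h : ℕ → ℕ)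
    (hbij : Set.BijOn h (Set.Icc 1 (p - 1)) (aperySet H p \ {0}))
    (hrel : ∀ i, 1 ≤ i → i ≤ p - 3 → h i + h (p - 2 - i) = h (p - 2))
    (hlast : 2 * h (p - 1) = h (p - 2) + p) :
    2 * (genus H : ℤ) = frobNum H + 2 := by
  have hadd := hH.2.1
  have hmem : ∀ i, 1 ≤ i → i ≤ p - 1 → h i ∈ aperySet H p := fun i h1 h2 =>
    (hbij.mapsTo ⟨h1, h2⟩).1
  have hmul : ∀ k, k * p ∈ H := fun k => by
    induction k with
    | zero => simpa using hH.1
    | succ k ih => rw [add_mul, one_mul]; exact hadd _ ih _ hpH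
  have hgap : ∀ n ∉ H, ∃ k i, 1 ≤ i ∧ i ≤ p - 1 ∧ h i = n + k * p + p := fun n hn => by
    obtain ⟨k, hk⟩ := hH.exists_add_mul_mem_aperySet (p := p) (by omega) hn
    obtain ⟨i, hi, hik⟩ := hbij.surjOn hk
    exact ⟨k, i, hi.1, hi.2, by rw [hik]; ring⟩
  have hcases : ∀ i, 1 ≤ i → i ≤ p - 1 → i ≤ p - 3 ∨ i = p - 2 ∨ i = p - 1 :=
    fun i _ _ => by omega
  have hpM : p ≤ h (p - 2) := by
    obtain ⟨n, hn⟩ := (Set.ne_univ_iff_exists_notMem H).1 hne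
    obtain ⟨k, i, h1, h2, hi⟩ := hgap n hn
    rcases hcases i h1 h2 with h3 | rfl | rfl
    · have := hrel i h1 h3
      omega
    · omega
    · omega
  obtain ⟨F, hF⟩ := Nat.exists_eq_add_of_le' hpM
  have hFgreatest : IsGreatest Hᶜ F := by
    refine ⟨(hmem (p - 2) (by omega) (by omega)).2 F hF.symm, fun n hn => ?_⟩
    obtain ⟨k, i, h1, h2, hi⟩ := hgap n hn
    rcases hcases i h1 h2 with h3 | rfl | rfl
    · have := hrel i h1 h3
      omega
    · omega
    · omega
  obtain ⟨c, hc⟩ := Nat.exists_eq_add_of_le' (show p ≤ h (p - 1) by omega)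
  have hgenus : 2 * genus H = F + 2 := by
    refine two_mul_genus_of_isGreatest hadd hFgreatest (c := c) (by omega)
      ((hmem (p - 1) (by omega) le_rfl).2 c hc.symm) fun x hx hxc => ?_
    obtain ⟨k, i, h1, h2, hi⟩ := hgap x hx
    rcases hcases i h1 h2 with h3 | rfl | rfl
    · have := hrel i h1 h3
      rw [show F - x = h (p - 2 - i) + k * p by omega]
      exact hadd _ (hmem _ (by omega) (by omega)).1 _ (hmul k)
    · rw [show F - x = k * p by omega]
      exact hmul k
    · cases k with
      | zero => omega
      | succ k =>
        rw [add_mul] at hi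
        rw [show F - x = h (p - 1) + k * p by omega]
        exact hadd _ (hmem _ (by omega) le_rfl).1 _ (hmul k)
  rw [frobNum_eq_of_isGreatest hFgreatest]
  exact_mod_cast hgenus
end

section
/- Let p > 3 be an integer. Every pseudo-symmetric numerical semigroup H with p ∈ H has embedding dimension edim(H) < p. -/
/-- The embedding dimension: cardinality of the minimal generating set
`(H∖{0}) ∖ ((H∖{0}) + (H∖{0}))`. -/
noncomputable def edim (H : Set ℕ) : ℕ :=
  ((H \ {0}) \ {n | ∃ a ∈ H \ {0}, ∃ b ∈ H \ {0}, n = a + b}).ncard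

theorem exists_frobNum_eq_natCast {H : Set ℕ} (hfin : Hᶜ.Finite) (h : frobNum H ≠ -1) :
    ∃ f : ℕ, frobNum H = f ∧ f ∉ H ∧ ∀ n, f < n → n ∈ H := by
  have hfinS : (insert (-1) ((fun n : ℕ => (n : ℤ)) '' Hᶜ)).Finite := (hfin.image _).insert _
  have hmem : frobNum H ∈ insert (-1) ((fun n : ℕ => (n : ℤ)) '' Hᶜ) :=
    (Set.insert_nonempty _ _).csSup_mem hfinS
  rcases hmem with hneg | ⟨f, hf, hfe⟩
  · exact absurd hneg h
  · refine ⟨f, hfe.symm, hf, fun n hn => ?_⟩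
    by_contra hnH
    have hle : (n : ℤ) ≤ frobNum H :=
      le_csSup hfinS.bddAbove (Set.mem_insert_of_mem _ ⟨n, hnH, rfl⟩)
    have hfe' : (f : ℤ) = frobNum H := hfe
    omega

/-- In a pseudo-symmetric semigroup, reflection in the Frobenius number sends every gap other
than half of the Frobenius number into the semigroup. -/
theorem sub_mem_of_notMem_of_pseudoSymmetric {H : Set ℕ} {f : ℕ}
    (hadd : ∀ a ∈ H, ∀ b ∈ H, a + b ∈ H) (hf : f ∉ H) (hgt : ∀ n, f < n → n ∈ H)
    (hg : 2 * genus H = f + 2) {x : ℕ} (hx : x ∉ H) (hxf : 2 * x ≠ f) : f - x ∈ H := by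
  classical
  by_contra hfx
  obtain ⟨k, rfl⟩ : ∃ k, f = 2 * k := ⟨genus H - 1, by omega⟩
  have hle : ∀ n, n ∉ H → n ≤ 2 * k := fun n hn => not_lt.1 fun h => hn (hgt n h)
  have hkH : k ∉ H := fun h => hf (by simpa [two_mul] using hadd k h k h)
  set A := (Finset.range (2 * k + 1)).filter (· ∈ H) with hA
  set B := (Finset.range (2 * k + 1)).filter (· ∉ H) with hB
  have hcard : A.card + B.card = 2 * k + 1 := by
    simpa using Finset.card_filter_add_card_filter_not (s := Finset.range (2 * k + 1)) (· ∈ H)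
  have hBg : B.card = genus H := by
    rw [genus, ← Set.ncard_coe_finset]
    congr 1
    ext n
    have := hle n
    simp only [hB, Finset.coe_filter, Finset.mem_range, Set.mem_ofPred_eq, Set.mem_compl_iff]
    constructor
    · exact fun h => h.2
    · exact fun h => ⟨by have := this h; omega, h⟩
  have hmemA : ∀ n, n ∈ A ↔ n ≤ 2 * k ∧ n ∈ H := by
    intro n; simp [hA]
  have hmemB : ∀ n, n ∈ B ↔ n ≤ 2 * k ∧ n ∉ H := by
    intro n; simp [hB]
  have hsub : insert k (insert x (A.image (2 * k - ·))) ⊆ B := by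
    intro n hn
    rw [hmemB]
    simp only [Finset.mem_insert, Finset.mem_image] at hn
    rcases hn with rfl | rfl | ⟨a, ha, rfl⟩
    · exact ⟨hle _ hkH, hkH⟩
    · exact ⟨hle _ hx, hx⟩
    · rw [hmemA] at ha
      refine ⟨Nat.sub_le _ _, fun h => hf ?_⟩
      have := hadd _ ha.2 _ h
      rwa [Nat.add_sub_cancel' ha.1] at this
  have hximg : x ∉ A.image (2 * k - ·) := by
    rw [Finset.mem_image]
    rintro ⟨a, ha, rfl⟩
    rw [hmemA] at ha
    exact hfx (by rw [Nat.sub_sub_self ha.1]; exact ha.2)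
  have hkimg : k ∉ insert x (A.image (2 * k - ·)) := by
    rw [Finset.mem_insert, Finset.mem_image]
    rintro (rfl | ⟨a, ha, hak⟩)
    · exact hxf rfl
    · rw [hmemA] at ha
      exact hkH (by rw [show k = a by omega]; exact ha.2)
  have hinj : (A.image (2 * k - ·)).card = A.card := by
    refine Finset.card_image_of_injOn fun a ha b hb hab => ?_
    have ha' := (hmemA a).1 ha
    have hb' := (hmemA b).1 hb
    have hab' : 2 * k - a = 2 * k - b := hab
    omega
  have := Finset.card_le_card hsub
  rw [Finset.card_insert_of_notMem hkimg, Finset.card_insert_of_notMem hximg, hinj] at this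
  omega

theorem exists_lt_notMem_of_three_lt {p : ℕ} (hp : 3 < p) (a b : ℕ) :
    ∃ r < p, r ≠ 0 ∧ r ≠ a ∧ r ≠ b := by
  have h : ({0, a, b} : Finset ℕ).card < (Finset.range p).card :=
    (Finset.card_le_three).trans_lt (by simpa using hp)
  obtain ⟨r, hr, hr'⟩ := Finset.exists_mem_notMem_of_card_lt_card h
  simp only [Finset.mem_insert, Finset.mem_singleton, not_or] at hr'
  exact ⟨r, Finset.mem_range.1 hr, hr'⟩

/-- For `p > 3`, every pseudo-symmetric numerical semigroup containing `p` has
embedding dimension `< p`. -/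
theorem edim_lt_of_pseudoSymmetric
    (p : ℕ) (hp : 3 < p) (H : Set ℕ) (hH : IsNumericalSemigroup H)
    (hpH : p ∈ H) (hps : 2 * (genus H : ℤ) = frobNum H + 2) :
    edim H < p := by
  obtain ⟨h0, hadd, hfin⟩ := hH
  obtain ⟨f, hfe, hf, hgt⟩ := exists_frobNum_eq_natCast hfin (by omega)
  have hg : 2 * genus H = f + 2 := by omega
  have hmul : ∀ k, p * k ∈ H := by
    intro k
    induction k with
    | zero => simpa using h0
    | succ k ih => exact hadd _ ih _ hpH
  by_contra! hcard
  rw [edim] at hcard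
  set G := (H \ {0}) \ {n | ∃ a ∈ H \ {0}, ∃ b ∈ H \ {0}, n = a + b}
  have hirr : ∀ a ∈ H, ∀ b ∈ H, a ≠ 0 → b ≠ 0 → a + b ∉ G :=
    fun a ha b hb ha0 hb0 h => h.2 ⟨a, ⟨ha, ha0⟩, b, ⟨hb, hb0⟩, rfl⟩
  have hmod : ∀ a b, a < b → a % p = b % p → ∃ k, k ≠ 0 ∧ b = a + p * k := by
    intro a b hab h
    obtain ⟨k, hk⟩ := (Nat.modEq_iff_dvd' hab.le).1 h
    exact ⟨k, by rintro rfl; omega, by omega⟩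
  have hlt : ∀ a ∈ H, a ≠ 0 → ∀ b ∈ G, a % p = b % p → b ≤ a := by
    intro a ha ha0 b hb h
    by_contra! hab
    obtain ⟨k, hk, rfl⟩ := hmod a b hab h
    exact hirr a ha _ (hmul k) ha0 (mul_ne_zero (by omega) hk) hb
  have hinj : Set.InjOn (· % p) G := fun a ha b hb h =>
    le_antisymm (hlt b hb.1.1 hb.1.2 a ha h.symm) (hlt a ha.1.1 ha.1.2 b hb h)
  have himg : (· % p) '' G = Set.Iio p := by
    refine Set.eq_of_subset_of_ncard_le ?_ ?_ (Set.finite_Iio p)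
    · rintro _ ⟨a, -, rfl⟩
      exact Nat.mod_lt _ (by omega)
    · rw [hinj.ncard_image]
      simpa [← Finset.coe_Iio, Set.ncard_coe_finset] using hcard
  have hsurj : ∀ r < p, ∃ w ∈ G, w % p = r := fun r hr => by
    have : r ∈ (· % p) '' G := himg ▸ hr
    exact this
  have hfpG : f + p ∈ G := by
    obtain ⟨w, hw, hwf⟩ := hsurj (f % p) (Nat.mod_lt _ (by omega))
    have hle : w ≤ f + p := hlt _ (hgt _ (by omega)) (by omega) w hw (by simp [hwf])
    have hfw : f < w := by
      by_contra! hwle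
      rcases hwle.eq_or_lt with rfl | h
      · exact hf hw.1.1
      · obtain ⟨k, -, rfl⟩ := hmod w f h hwf
        exact hf (hadd _ hw.1.1 _ (hmul k))
    obtain ⟨k, hk, rfl⟩ := hmod f w hfw hwf.symm
    have : p ≤ p * k := Nat.le_mul_of_pos_right p (Nat.pos_of_ne_zero hk)
    rwa [show f + p * k = f + p by omega] at hw
  obtain ⟨r, hr, hr0, hrf, hrk⟩ := exists_lt_notMem_of_three_lt hp (f % p) (f / 2 % p)
  obtain ⟨w, hw, rfl⟩ := hsurj r hr
  have hle : w ≤ f + p := by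
    by_contra! h
    refine hirr p hpH (w - p) (hgt _ (by omega)) (by omega) (by omega) ?_
    rwa [Nat.add_sub_cancel' (by omega)]
  have hne : w ≠ f + p := by
    rintro rfl
    exact hrf (by simp)
  have hcompl : f + p - w ∈ H := by
    rcases lt_or_ge w p with h | h
    · exact hgt _ (by omega)
    · obtain ⟨x, rfl⟩ := Nat.exists_eq_add_of_le h
      rw [Nat.add_mod_left] at hr0 hrk
      have hx : x ∉ H := fun hx => hirr p hpH x hx (by omega) (by rintro rfl; simp at hr0) hw
      have hxf : 2 * x ≠ f := by
        rintro rfl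
        simp at hrk
      have := sub_mem_of_notMem_of_pseudoSymmetric hadd hf hgt hg hx hxf
      rwa [show f + p - (p + x) = f - x by omega]
  refine hirr w hw.1.1 _ hcompl hw.1.2 (by omega) ?_
  rwa [Nat.add_sub_cancel' hle]
end

section
/- Let p ≥ 3 be an integer and let α = (α_1,…,α_{p−1}) ∈ ℕ^{p−1} have gcd(α_1,…,α_{p−1}) = 1. Assume that Σ_{i=1}^{p−1} α_i·μ_i > 0 for every nonzero μ = (μ_1,…,μ_{p−1}) ∈ ℕ^{p−1} satisfying μ_i + μ_j ≥ μ_{(i+j mod p)} for all 1 ≤ i,j ≤ p−1 with i + j ≢ 0 (mod p). Then the function f_α : ℕ → ℕ given by f_α(n) = #{μ ∈ ℕ^{p−1} : μ_i + μ_j ≥ μ_{i+j} whenever i+j < p, μ_i + μ_j ≥ μ_{i+j−p} − 1 whenever i+j > p, and Σ_{i=1}^{p−1} α_i·μ_i = n} is a quasi-polynomial of degree p−2, and the coefficient of T^{p−2} in each of its constituent polynomials is non-negative. -/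
/-- Membership in the cone `C_p`: `μ_i + μ_j ≥ μ_{i+j}` whenever `i + j < p`, and
`μ_i + μ_j ≥ μ_{i+j-p} - 1` whenever `i + j > p`, indices ranging over `1,…,p-1`. -/
def MemCp (p : ℕ) (μ : ℕ → ℕ) : Prop :=
  ∀ i ∈ Finset.Icc 1 (p - 1), ∀ j ∈ Finset.Icc 1 (p - 1),
    (i + j < p → μ (i + j) ≤ μ i + μ j) ∧
    (p < i + j → μ (i + j - p) ≤ μ i + μ j + 1)

/-- Membership in the translated cone `C_p^*`: `μ_i + μ_j ≥ μ_{(i+j) mod p}` for all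
`i, j ∈ {1,…,p-1}` with `i + j ≢ 0 (mod p)`. -/
def MemCpStar (p : ℕ) (μ : ℕ → ℕ) : Prop :=
  ∀ i ∈ Finset.Icc 1 (p - 1), ∀ j ∈ Finset.Icc 1 (p - 1),
    i + j ≠ p → μ ((i + j) % p) ≤ μ i + μ j

/-- `μ : ℕ → ℕ` represents a point of `ℕ^{p-1}` (coordinates indexed by `1,…,p-1`,
all other values being `0`). -/
def IsTuple (p : ℕ) (μ : ℕ → ℕ) : Prop :=
  ∀ i, i ∉ Finset.Icc 1 (p - 1) → μ i = 0

/-- The number of lattice points of `C_p` on the hyperplane `α ⬝ x = n`. -/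
noncomputable def latticeCount (p : ℕ) (α : ℕ → ℕ) (n : ℕ) : ℕ :=
  {μ : ℕ → ℕ | IsTuple p μ ∧ MemCp p μ ∧ ∑ i ∈ Finset.Icc 1 (p - 1), α i * μ i = n}.ncard

open scoped ENNReal Polynomial

/-- The sum of `F` over all combinations of the vectors of a list with positive integer
coefficients. -/
noncomputable def openConeSum {V : Type} [AddCommMonoid V] : List V → (V → ℝ≥0∞) → ℝ≥0∞
  | [], F => F 0
  | v :: L, F => ∑' k : ℕ, openConeSum L fun x => F (x + (k + 1) • v)

section openConeSum

variable {V : Type} [AddCommMonoid V]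

lemma openConeSum_perm {L L' : List V} (h : L.Perm L') (F : V → ℝ≥0∞) :
    openConeSum L F = openConeSum L' F := by
  induction h generalizing F with
  | nil => rfl
  | cons v _ ih => simp only [openConeSum, ih]
  | swap u v L =>
    simp only [openConeSum]
    rw [ENNReal.tsum_comm]
    simp only [add_assoc, add_comm ((_ + 1 : ℕ) • u)]
  | trans _ _ ih₁ ih₂ => rw [ih₁, ih₂]

lemma openConeSum_congr (A : AddSubmonoid V) {L : List V} (hL : ∀ v ∈ L, v ∈ A)
    {F F' : V → ℝ≥0∞} (h : ∀ x ∈ A, F x = F' x) : openConeSum L F = openConeSum L F' := by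
  induction L generalizing F F' with
  | nil => exact h 0 A.zero_mem
  | cons v L ih =>
    simp only [List.forall_mem_cons] at hL
    simp only [openConeSum]
    exact tsum_congr fun k =>
      ih hL.2 fun x hx => h _ (A.add_mem hx (A.nsmul_mem hL.1 _))

lemma openConeSum_zero (L : List V) : openConeSum L (fun _ => 0) = 0 := by
  induction L with
  | nil => rfl
  | cons v L ih => simp [openConeSum, ih]

lemma openConeSum_ofFn {n : ℕ} (v : Fin n → V) (F : V → ℝ≥0∞) :
    openConeSum (List.ofFn v) F = ∑' c : Fin n → ℕ, F (∑ i, (c i + 1) • v i) := by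
  induction n generalizing F with
  | zero => simp [openConeSum]
  | succ n ih =>
    rw [List.ofFn_succ, openConeSum, ← (Fin.consEquiv fun _ => ℕ).tsum_eq, ENNReal.tsum_prod']
    refine tsum_congr fun k => ?_
    rw [ih]
    simp [Fin.consEquiv, Fin.sum_univ_succ, add_comm]

lemma tsum_tsum_eq_lt_add_eq_add_gt (f : ℕ → ℕ → ℝ≥0∞) :
    ∑' a, ∑' b, f a b = ∑' b, ∑' k, f (b + k + 1) b + ∑' a, f a a +
      ∑' a, ∑' k, f a (a + k + 1) := by
  have split (g : ℕ → ℝ≥0∞) (a : ℕ) :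
      ∑' b, g b = ∑ b ∈ Finset.range a, g b + (g a + ∑' k, g (a + k + 1)) := by
    rw [← ENNReal.summable.sum_add_tsum_nat_add' (f := g) (k := a + 1), Finset.sum_range_succ,
      add_assoc]
    simp only [show ∀ k, k + (a + 1) = a + k + 1 by omega]
  have triangle : ∑' a, ∑ b ∈ Finset.range a, f a b = ∑' b, ∑' k, f (b + k + 1) b := by
    have h1 : ∀ a, ∑ b ∈ Finset.range a, f a b = ∑' b, if b < a then f a b else 0 := by
      intro a
      rw [tsum_eq_sum (s := Finset.range a)]
      · exact Finset.sum_congr rfl fun b hb => by simp [Finset.mem_range.1 hb]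
      · intro b hb
        simp at hb
        simp [hb]
    simp only [h1]
    rw [ENNReal.tsum_comm]
    refine tsum_congr fun b => ?_
    rw [split _ b, Finset.sum_eq_zero]
    · simp [show ∀ k, b < b + k + 1 by omega]
    · intro a ha
      simp at ha
      simp [ha.le]
  simp only [fun a => split (f a) a]
  rw [ENNReal.tsum_add, ENNReal.tsum_add, triangle, add_assoc]

lemma openConeSum_cons_cons (u v : V) (L : List V) (F : V → ℝ≥0∞) :
    openConeSum (u :: v :: L) F = openConeSum ((u + v) :: u :: L) F +
      openConeSum ((u + v) :: L) F + openConeSum ((u + v) :: v :: L) F := by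
  simp only [openConeSum]
  rw [tsum_tsum_eq_lt_add_eq_add_gt]
  congr 1
  · congr 1
    · refine tsum_congr fun b => tsum_congr fun k => ?_
      congr 1; funext x; congr 1
      simp only [smul_add, add_smul]; abel
    · refine tsum_congr fun b => ?_
      congr 1; funext x; congr 1
      simp only [smul_add, add_smul]; abel
  · refine tsum_congr fun b => tsum_congr fun k => ?_
    congr 1; funext x; congr 1
    simp only [smul_add, add_smul]; abel

lemma List.exists_perm_cons_cons_of_mem {W : Type} {u v : W} {L : List W} (hu : u ∈ L)
    (hv : v ∈ L) (h : v ≠ u) :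
    ∃ L', L.Perm (u :: v :: L') := by
  classical
  refine ⟨(L.erase u).erase v, (List.perm_cons_erase hu).trans (List.Perm.cons _ ?_)⟩
  exact List.perm_cons_erase ((List.mem_erase_of_ne h).2 hv)

/-- `P` is a subdivision of the part of the open cone over `L` lying in `K`: every member of `P`
is generated by elements of the semigroup spanned by `L`. -/
def IsConeSubdivision (K : Set V) (L : List V) {τ : Type} [Fintype τ] (P : τ → List V) : Prop :=
  (∀ t, (P t).length ≤ L.length) ∧
  (∀ A : AddSubsemigroup V, (∀ v ∈ L, v ∈ A) → ∀ t, ∀ v ∈ P t, v ∈ A) ∧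
  ∀ F, openConeSum L (K.indicator F) = ∑ t, openConeSum (P t) F

lemma exists_isConeSubdivision_halfSpace_aux (l : V →+ ℤ) (s : ℕ) :
    ∀ (r a b : ℕ), a + b = s → ∀ L : List V, (∀ v ∈ L, l v ≤ a) → (∀ v ∈ L, -(b : ℤ) ≤ l v) →
      L.countP (fun v => l v = a) + L.countP (fun v => l v = -b) = r →
      ∃ (τ : Type) (_ : Fintype τ) (P : τ → List V),
        IsConeSubdivision {x | 0 ≤ l x} L P ∧ ∀ t, ∀ v ∈ P t, 0 ≤ l v := by
  induction s using Nat.strong_induction_on with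
  | _ s ihs =>
  intro r
  induction r using Nat.strong_induction_on with
  | _ r ihr =>
  intro a b hab L ha hb hr
  by_cases hnonneg : ∀ v ∈ L, 0 ≤ l v
  · refine ⟨Unit, inferInstance, fun _ => L, ⟨fun _ => le_rfl, fun A hA _ => hA, fun F => ?_⟩,
      fun _ => hnonneg⟩
    rw [Fintype.sum_unique]
    refine openConeSum_congr ((AddSubmonoid.nonneg ℤ).comap l) hnonneg fun x hx => ?_
    exact Set.indicator_of_mem (s := {x | 0 ≤ l x}) hx F
  push Not at hnonneg
  obtain ⟨w, hwL, hw⟩ := hnonneg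
  by_cases hnonpos : ∀ v ∈ L, l v ≤ 0
  · refine ⟨Empty, inferInstance, Empty.elim, ⟨by simp, by simp, fun F => ?_⟩, by simp⟩
    classical
    rw [openConeSum_perm (List.perm_cons_erase hwL), openConeSum]
    simp only [Finset.univ_eq_empty, Finset.sum_empty, ENNReal.tsum_eq_zero]
    intro k
    rw [← openConeSum_zero (L.erase w)]
    refine openConeSum_congr ((AddSubmonoid.nonneg ℤ).comap (-l)) ?_ fun x hx => ?_
    · intro v hv
      simpa using hnonpos v (List.mem_of_mem_erase hv)
    · refine Set.indicator_of_notMem ?_ F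
      have hx : l x ≤ 0 := by simpa using hx
      simp only [Set.mem_ofPred_eq, map_add, map_nsmul, not_le, nsmul_eq_mul]
      push_cast
      nlinarith
  push Not at hnonpos
  obtain ⟨z, hzL, hz⟩ := hnonpos
  by_cases hA : ∃ u ∈ L, l u = a
  swap
  · push Not at hA
    have := ha z hzL
    refine ihs (s - 1) (by omega) _ (a - 1) b (by omega) L (fun v hv => ?_) hb rfl
    have := ha v hv
    have := hA v hv
    omega
  by_cases hB : ∃ v ∈ L, l v = -b
  swap
  · push Not at hB
    have := hb w hwL
    refine ihs (s - 1) (by omega) _ a (b - 1) (by omega) L ha (fun v hv => ?_) rfl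
    have := hb v hv
    have := hB v hv
    omega
  obtain ⟨u, huL, hu⟩ := hA
  obtain ⟨v, hvL, hv⟩ := hB
  have hapos : 0 < a := by have := ha z hzL; omega
  have hbpos : 0 < b := by have := hb w hwL; omega
  have huv : v ≠ u := by rintro rfl; omega
  obtain ⟨M, hM⟩ := List.exists_perm_cons_cons_of_mem huL hvL huv
  have hmem : ∀ x ∈ M, x ∈ L := fun x hx => hM.mem_iff.2 (by simp [hx])
  rw [hM.countP_eq, hM.countP_eq] at hr
  have h1 : ¬ (-(b : ℤ) = a) := by omega
  have h2 : ¬ ((a : ℤ) = -b) := by omega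
  have h3 : ¬ ((a : ℤ) + -b = a) := by omega
  have h4 : ¬ ((a : ℤ) + -b = -b) := by omega
  simp only [List.countP_cons, hu, hv, h1, h2, decide_true, decide_false] at hr
  have refine_list (N : List V) (hN : ∀ x ∈ N, x = u + v ∨ x ∈ L)
      (hc : N.countP (fun v => l v = a) + N.countP (fun v => l v = -b) < r) :
      ∃ (τ : Type) (_ : Fintype τ) (P : τ → List V),
        IsConeSubdivision {x | 0 ≤ l x} N P ∧ ∀ t, ∀ v ∈ P t, 0 ≤ l v :=
    ihr _ hc a b hab N
      (fun x hx => by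
        rcases hN x hx with rfl | h
        · rw [map_add]; omega
        · exact ha x h)
      (fun x hx => by
        rcases hN x hx with rfl | h
        · rw [map_add]; omega
        · exact hb x h) rfl
  obtain ⟨τ₁, _, P₁, hP₁, hp₁⟩ := refine_list ((u + v) :: u :: M)
    (by simp +contextual [huL, hmem])
    (by
      simp only [List.countP_cons, map_add, hu, hv, h2, h3, h4, decide_true, decide_false]
      simp at hr ⊢; omega)
  obtain ⟨τ₂, _, P₂, hP₂, hp₂⟩ := refine_list ((u + v) :: M)
    (by simp +contextual [hmem])
    (by
      simp only [List.countP_cons, map_add, hu, hv, h3, h4, decide_false]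
      simp at hr ⊢; omega)
  obtain ⟨τ₃, _, P₃, hP₃, hp₃⟩ := refine_list ((u + v) :: v :: M)
    (by simp +contextual [hvL, hmem])
    (by
      simp only [List.countP_cons, map_add, hu, hv, h1, h3, h4, decide_true, decide_false]
      simp at hr ⊢; omega)
  have hlen := hM.length_eq
  simp only [List.length_cons] at hlen
  refine ⟨(τ₁ ⊕ τ₂) ⊕ τ₃, inferInstance, Sum.elim (Sum.elim P₁ P₂) P₃, ⟨?_, ?_, ?_⟩, ?_⟩
  · have e₁ := hP₁.1
    have e₂ := hP₂.1
    have e₃ := hP₃.1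
    simp only [List.length_cons] at e₁ e₂ e₃
    rintro ((t | t) | t)
    · exact (e₁ t).trans hlen.ge
    · exact (e₂ t).trans (by omega)
    · exact (e₃ t).trans hlen.ge
  · intro A hA
    have hu := hA u huL
    have hv := hA v hvL
    have huv := A.add_mem hu hv
    have hM' : ∀ x ∈ M, x ∈ A := fun x hx => hA x (hmem x hx)
    rintro ((t | t) | t)
    · exact hP₁.2.1 A (by simpa [hu, huv] using hM') t
    · exact hP₂.2.1 A (by simpa [huv] using hM') t
    · exact hP₃.2.1 A (by simpa [hv, huv] using hM') t
  · intro F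
    rw [openConeSum_perm hM, openConeSum_cons_cons, hP₁.2.2, hP₂.2.2, hP₃.2.2]
    simp
  · rintro ((t | t) | t)
    · exact hp₁ t
    · exact hp₂ t
    · exact hp₃ t

lemma exists_isConeSubdivision_halfSpace (l : V →+ ℤ) (L : List V) :
    ∃ (τ : Type) (_ : Fintype τ) (P : τ → List V),
      IsConeSubdivision {x | 0 ≤ l x} L P ∧ ∀ t, ∀ v ∈ P t, 0 ≤ l v := by
  have hle : ∀ v ∈ L, (l v).natAbs ≤ (L.map fun v => (l v).natAbs).sum := fun v hv =>
    List.single_le_sum (by simp) _ (List.mem_map_of_mem hv)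
  exact exists_isConeSubdivision_halfSpace_aux l _ _ (L.map fun v => (l v).natAbs).sum
    (L.map fun v => (l v).natAbs).sum rfl L
    (fun v hv => by have := hle v hv; omega) (fun v hv => by have := hle v hv; omega) rfl

lemma exists_isConeSubdivision (ls : List (V →+ ℤ)) (L : List V) :
    ∃ (τ : Type) (_ : Fintype τ) (P : τ → List V),
      IsConeSubdivision {x | ∀ l ∈ ls, 0 ≤ l x} L P ∧
        ∀ t, ∀ v ∈ P t, ∀ l ∈ ls, 0 ≤ l v := by
  induction ls generalizing L with
  | nil =>
    refine ⟨Unit, inferInstance, fun _ => L, ⟨fun _ => le_rfl, fun A hA _ => hA, fun F => ?_⟩,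
      by simp⟩
    simp
  | cons l ls ih =>
    obtain ⟨τ, _, P, hP, hp⟩ := exists_isConeSubdivision_halfSpace l L
    choose σ hσ Q hQ hq using fun t => ih (P t)
    refine ⟨Σ t, σ t, inferInstance, fun t => Q t.1 t.2, ⟨?_, ?_, ?_⟩, ?_⟩
    · exact fun t => ((hQ t.1).1 t.2).trans (hP.1 t.1)
    · exact fun A hA t => (hQ t.1).2.1 A (hP.2.1 A hA t.1) t.2
    · intro F
      have : {x | ∀ k ∈ l :: ls, 0 ≤ k x} = {x | 0 ≤ l x} ∩ {x | ∀ k ∈ ls, 0 ≤ k x} := by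
        ext; simp
      rw [this, ← Set.indicator_indicator, hP.2.2, Fintype.sum_sigma]
      exact Finset.sum_congr rfl fun t _ => (hQ t).2.2 F
    · rintro ⟨t, s⟩ v hv k hk
      rcases List.mem_cons.1 hk with rfl | hk
      · exact (hQ t).2.1 ((AddSubmonoid.nonneg ℤ).comap k).toAddSubsemigroup (hp t) s v hv
      · exact hq t s v hv k hk

end openConeSum

/-- The number of ways to write `m = e + N (q_1 + … + q_k)` with `q ∈ ℕ^k`. -/
def multichooseCount (N k m e : ℕ) : ℕ :=
  if e ≤ m ∧ N ∣ m - e then Nat.multichoose k ((m - e) / N) else 0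

lemma Nat.sum_range_multichoose_sub (k n : ℕ) :
    ∑ q ∈ Finset.range (n + 1), Nat.multichoose k (n - q) = Nat.multichoose (k + 1) n := by
  refine (Finset.sum_range_reflect (Nat.multichoose k) (n + 1)).trans ?_
  induction n with
  | zero => simp
  | succ n ih => rw [Finset.sum_range_succ, ih, Nat.multichoose_succ_succ, add_comm]

lemma tsum_multichooseCount {N : ℕ} (hN : 0 < N) (k m e : ℕ) :
    ∑' q : ℕ, (multichooseCount N k m (e + N * q) : ℝ≥0∞) = multichooseCount N (k + 1) m e := by
  by_cases h : e ≤ m ∧ N ∣ m - e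
  · obtain ⟨Q, hQ⟩ := h.2
    obtain rfl : m = e + N * Q := by omega
    have key : ∀ q, multichooseCount N k (e + N * Q) (e + N * q) =
        if q ≤ Q then Nat.multichoose k (Q - q) else 0 := by
      intro q
      by_cases hq : q ≤ Q
      · have : e + N * Q - (e + N * q) = N * (Q - q) := by
          rw [Nat.add_sub_add_left, Nat.mul_sub]
        simp [multichooseCount, this, hq, hN]
      · simp [multichooseCount, hq, hN]
    have key' : multichooseCount N (k + 1) (e + N * Q) e = Nat.multichoose (k + 1) Q := by
      simp [multichooseCount, hN]
    rw [key', ← Nat.sum_range_multichoose_sub, tsum_eq_sum (s := Finset.range (Q + 1))]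
    · push_cast
      refine Finset.sum_congr rfl fun q hq => ?_
      rw [key, if_pos (by simpa [Nat.lt_succ_iff] using hq)]
    · intro q hq
      rw [key, if_neg (by simpa [Nat.lt_succ_iff] using hq), Nat.cast_zero]
  · rw [multichooseCount, if_neg h, Nat.cast_zero, ENNReal.tsum_eq_zero]
    intro q
    rw [multichooseCount, if_neg, Nat.cast_zero]
    rintro ⟨h₁, h₂⟩
    refine h ⟨by omega, ?_⟩
    obtain ⟨Q, hQ⟩ := h₂
    exact ⟨Q + q, by rw [mul_add]; omega⟩

lemma ENNReal.tsum_nat_eq_sum_tsum_residue (f : ℕ → ℝ≥0∞) {n : ℕ} (hn : 0 < n) :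
    ∑' k, f k = ∑ j : Fin n, ∑' q, f (n * q + j) := by
  have : NeZero n := ⟨hn.ne'⟩
  rw [← (Nat.divModEquiv n).symm.tsum_eq, ENNReal.tsum_prod', ENNReal.tsum_comm, tsum_fintype]
  simp [mul_comm]

lemma exists_openConeSum_eq_sum_multichooseCount {V : Type} [AddCommMonoid V] (w : V →+ ℕ)
    {p N : ℕ} (hN : 0 < N) (L : List V) (hL : ∀ v ∈ L, ∃ n, 0 < n ∧ p ∣ n ∧ n * w v = N) :
    ∃ (τ : Type) (_ : Fintype τ) (x : τ → V),
      (∀ t, w (x t) ≤ L.length * N ∧ (w (x t) = L.length * N → ∃ y, x t = p • y)) ∧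
      ∀ G : V → ℕ, (∀ x y, G (x + p • y) = G x) → ∀ m y,
        openConeSum L (fun x => if w (x + y) = m then (G (x + y) : ℝ≥0∞) else 0) =
          ∑ t, (G (x t + y) : ℝ≥0∞) * multichooseCount N L.length m (w (x t + y)) := by
  induction L with
  | nil =>
    refine ⟨Unit, inferInstance, fun _ => 0, fun _ => ⟨by simp, fun _ => ⟨0, by simp⟩⟩,
      fun G _ m y => ?_⟩
    have : multichooseCount N 0 m (w y) = if w y = m then 1 else 0 := by
      by_cases h : w y = m
      · simp [multichooseCount, h]
      · by_cases h' : w y ≤ m ∧ N ∣ m - w y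
        · obtain ⟨Q, hQ⟩ := h'.2
          rw [multichooseCount, if_pos h', if_neg h, hQ, Nat.mul_div_cancel_left _ hN]
          cases Q with
          | zero => omega
          | succ Q => simp
        · rw [multichooseCount, if_neg h', if_neg h]
    simp [openConeSum, this]
  | cons v L ih =>
    obtain ⟨τ, _, x, hx, hsum⟩ := ih fun v hv => hL v (List.mem_cons_of_mem _ hv)
    obtain ⟨n, hn, ⟨r, rfl⟩, hnN⟩ := hL v List.mem_cons_self
    refine ⟨Fin (p * r) × τ, inferInstance, fun t => x t.2 + (t.1 + 1 : ℕ) • v, ?_, ?_⟩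
    · rintro ⟨j, t⟩
      obtain ⟨h₁, h₂⟩ := hx t
      have hj : (j : ℕ) + 1 ≤ p * r := j.2
      have hw : w (x t + (j + 1 : ℕ) • v) = w (x t) + (j + 1) * w v := by simp
      have hlen : (v :: L).length * N = L.length * N + N := by simp [add_mul]
      have hj' := Nat.mul_le_mul_right (w v) hj
      simp only [hw, hlen]
      refine ⟨by omega, fun h => ?_⟩
      obtain ⟨y, hy⟩ := h₂ (by omega)
      have hwv : 0 < w v := Nat.pos_of_ne_zero fun h0 => by simp [h0] at hnN; omega
      have : (j : ℕ) + 1 = p * r := Nat.eq_of_mul_eq_mul_right hwv (by omega)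
      exact ⟨y + r • v, by rw [this, hy, smul_add, mul_smul]⟩
    · intro G hG m y
      have hperiod : ∀ (z : V) (q : ℕ), G (z + (p * r * q) • v) = G z := fun z q => by
        rw [mul_assoc, mul_smul, hG]
      rw [openConeSum, ENNReal.tsum_nat_eq_sum_tsum_residue _ hn, Fintype.sum_prod_type]
      refine Finset.sum_congr rfl fun j _ => ?_
      have hterm : ∀ q : ℕ, openConeSum L (fun z =>
          if w (z + (p * r * q + j + 1) • v + y) = m
            then (G (z + (p * r * q + j + 1) • v + y) : ℝ≥0∞) else 0) =
          ∑ t, (G (x t + (j + 1 : ℕ) • v + y) : ℝ≥0∞) *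
            multichooseCount N L.length m (w (x t + (j + 1 : ℕ) • v + y) + N * q) := by
        intro q
        simp only [add_assoc _ _ y]
        rw [hsum G hG]
        refine Finset.sum_congr rfl fun t _ => ?_
        have : x t + ((p * r * q + (j + 1)) • v + y) =
            x t + ((j + 1 : ℕ) • v + y) + (p * r * q) • v := by
          rw [add_smul]; abel
        rw [add_assoc (p * r * q), this, hperiod, map_add w _ ((p * r * q) • v), map_nsmul,
          ← hnN, smul_eq_mul]
        congr 4
        ring
      simp only [hterm]
      rw [Summable.tsum_finsetSum fun _ _ => ENNReal.summable]
      refine Finset.sum_congr rfl fun t _ => ?_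
      rw [ENNReal.tsum_mul_left, tsum_multichooseCount hN, List.length_cons]

/-- `g` is given on each residue class modulo `N` by a polynomial of degree at most `D`. -/
def IsQuasiPolynomial (N D : ℕ) (g : ℕ → ℝ) : Prop :=
  ∃ c : ℕ → ℝ[X], (∀ i, (c i).natDegree ≤ D) ∧ ∀ n, g n = (c (n % N)).eval (n : ℝ)

namespace IsQuasiPolynomial

variable {N D : ℕ}

lemma zero : IsQuasiPolynomial N D fun _ => 0 := ⟨fun _ => 0, by simp, by simp⟩

lemma const_mul {g : ℕ → ℝ} (a : ℝ) (hg : IsQuasiPolynomial N D g) :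
    IsQuasiPolynomial N D fun n => a * g n := by
  obtain ⟨c, hc, h⟩ := hg
  refine ⟨fun i => Polynomial.C a * c i,
    fun i => (Polynomial.natDegree_C_mul_le a (c i)).trans (hc i), fun n => ?_⟩
  rw [Polynomial.eval_mul, Polynomial.eval_C, ← h]

lemma sum {τ : Type} [Fintype τ] {g : τ → ℕ → ℝ} (hg : ∀ t, IsQuasiPolynomial N D (g t)) :
    IsQuasiPolynomial N D fun n => ∑ t, g t n := by
  choose c hc h using hg
  refine ⟨fun i => ∑ t, c t i, fun i => Polynomial.natDegree_sum_le_of_forall_le _ _ fun t _ => hc t i,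
    fun n => ?_⟩
  rw [Polynomial.eval_finsetSum]
  exact Finset.sum_congr rfl fun t _ => h t n

lemma comp_linear {g : ℕ → ℝ} (hg : IsQuasiPolynomial N D g) (p a : ℕ) :
    IsQuasiPolynomial N D fun n => g (p * n + a) := by
  obtain ⟨c, hc, h⟩ := hg
  refine ⟨fun i => (c ((p * i + a) % N)).comp (.C (p : ℝ) * .X + .C (a : ℝ)), fun i => ?_,
    fun n => ?_⟩
  · refine Polynomial.natDegree_comp_le.trans ((Nat.mul_le_mul (hc _)
      Polynomial.natDegree_linear_le).trans (by simp))
  · dsimp only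
    rw [h]
    have : (p * (n % N) + a) % N = (p * n + a) % N := by
      simp [Nat.add_mod, Nat.mul_mod]
    simp [this]

lemma multichooseCount (hN : 0 < N) {k e : ℕ} (hk : k ≤ D + 1) (he : e < k * N) :
    IsQuasiPolynomial N D fun m => (multichooseCount N k m e : ℝ) := by
  obtain ⟨j, rfl⟩ : ∃ j, k = j + 1 := ⟨k - 1, by cases k <;> simp at he ⊢⟩
  have hN' : (N : ℝ) ≠ 0 := by positivity
  refine ⟨fun i => if i % N = e % N then .C ((j.factorial : ℝ)⁻¹) *
    (ascPochhammer ℝ j).comp (.C (N : ℝ)⁻¹ * .X + .C (1 - e / N)) else 0, fun i => ?_,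
    fun m => ?_⟩
  · dsimp only
    split_ifs
    · refine (Polynomial.natDegree_C_mul_le _ _).trans (Polynomial.natDegree_comp_le.trans ?_)
      refine (Nat.mul_le_mul (ascPochhammer_natDegree ℝ j).le
        Polynomial.natDegree_linear_le).trans (by omega)
    · simp
  · dsimp only
    rw [Nat.mod_mod]
    split_ifs with h
    · rcases le_or_gt e m with hem | hem
      · obtain ⟨q, hq⟩ := (Nat.modEq_iff_dvd' hem).1 (Eq.symm h)
        obtain rfl : m = e + N * q := by omega
        have harg : (N : ℝ)⁻¹ * ((e + N * q : ℕ) : ℝ) + (1 - e / N) = ((q + 1 : ℕ) : ℝ) := by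
          push_cast; field_simp; ring
        have hval : _root_.multichooseCount N (j + 1) (e + N * q) e =
            Nat.multichoose (j + 1) q := by simp [_root_.multichooseCount, hN]
        simp only [hval, Polynomial.eval_mul, Polynomial.eval_C, Polynomial.eval_comp,
          Polynomial.eval_add, Polynomial.eval_X, harg]
        rw [ascPochhammer_nat_eq_natCast_ascFactorial, Nat.ascFactorial_eq_factorial_mul_choose,
          Nat.multichoose_eq, show j + 1 + q - 1 = q + j by omega, Nat.choose_symm_add]
        push_cast
        field_simp
      · obtain ⟨t, ht⟩ := (Nat.modEq_iff_dvd' hem.le).1 h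
        have ht0 : 0 < t := Nat.pos_of_ne_zero fun h0 => by simp [h0] at ht; omega
        have htj : t < j + 1 := by
          by_contra hcon
          have := Nat.mul_le_mul_left N (not_lt.1 hcon)
          rw [mul_comm N (j + 1)] at this
          omega
        obtain rfl : e = m + N * t := by omega
        have harg : (N : ℝ)⁻¹ * (m : ℝ) + (1 - ((m + N * t : ℕ) : ℝ) / N) =
            -((t - 1 : ℕ) : ℝ) := by
          rw [Nat.cast_sub (show 1 ≤ t from ht0)]
          push_cast; field_simp; ring
        simp only [Polynomial.eval_mul, Polynomial.eval_C, Polynomial.eval_comp,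
          Polynomial.eval_add, Polynomial.eval_X, harg]
        rw [ascPochhammer_eval_neg_coe_nat_of_lt (by omega), _root_.multichooseCount,
          if_neg (by omega)]
        simp
    · rw [_root_.multichooseCount, if_neg]
      · simp
      · rintro ⟨h₁, h₂⟩
        exact h ((Nat.modEq_iff_dvd' h₁).2 h₂).symm

end IsQuasiPolynomial

/-- The weight `α ⬝ x`, as an additive map. -/
def weight (p : ℕ) (α : ℕ → ℕ) : (ℕ → ℕ) →+ ℕ where
  toFun x := ∑ i ∈ Finset.Icc 1 (p - 1), α i * x i
  map_zero' := by simp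
  map_add' x y := by simp [mul_add, Finset.sum_add_distrib]

lemma weight_apply (p : ℕ) (α x : ℕ → ℕ) :
    weight p α x = ∑ i ∈ Finset.Icc 1 (p - 1), α i * x i := rfl

/-- The lattice points counted by `latticeCount`. -/
def latticePoints (p : ℕ) (α : ℕ → ℕ) (n : ℕ) : Set (ℕ → ℕ) :=
  {μ | IsTuple p μ ∧ MemCp p μ ∧ weight p α μ = n}

/-- The linear form `x_i + x_j - x_{(i+j) mod p}`. -/
def coneForm (p i j : ℕ) : (ℕ → ℕ) →+ ℤ where
  toFun x := x i + x j - x ((i + j) % p)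
  map_zero' := by simp
  map_add' x y := by simp only [Pi.add_apply]; push_cast; ring

/-- The linear forms defining `C_p^*`. -/
noncomputable def coneForms (p : ℕ) : List ((ℕ → ℕ) →+ ℤ) :=
  ((Finset.Icc 1 (p - 1) ×ˢ Finset.Icc 1 (p - 1)).filter fun q => q.1 + q.2 ≠ p).toList.map
    fun q => coneForm p q.1 q.2

lemma forall_coneForms_nonneg_iff {p : ℕ} {x : ℕ → ℕ} :
    (∀ l ∈ coneForms p, 0 ≤ l x) ↔ MemCpStar p x := by
  have h : ∀ i j, 0 ≤ coneForm p i j x ↔ x ((i + j) % p) ≤ x i + x j := fun i j => by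
    change (0 : ℤ) ≤ x i + x j - x ((i + j) % p) ↔ _
    omega
  simp only [coneForms, List.forall_mem_map, Finset.mem_toList, Finset.mem_filter,
    Finset.mem_product, h, MemCpStar, Prod.forall]
  exact ⟨fun H i hi j hj hij => H i j ⟨⟨hi, hj⟩, hij⟩, fun H i j hij => H i hij.1.1 j hij.1.2 hij.2⟩

/-- The translate `p μ + (1, …, p - 1)`, which carries `C_p` into `C_p^*`. -/
def coneLift (p : ℕ) (μ : ℕ → ℕ) (i : ℕ) : ℕ :=
  if i ∈ Finset.Icc 1 (p - 1) then p * μ i + i else 0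

lemma memCpStar_coneLift_iff {p : ℕ} {μ : ℕ → ℕ} : MemCpStar p (coneLift p μ) ↔ MemCp p μ := by
  unfold MemCpStar MemCp
  refine forall₂_congr fun i hi => forall₂_congr fun j hj => ?_
  have hi' := Finset.mem_Icc.1 hi
  have hj' := Finset.mem_Icc.1 hj
  have hp : 0 < p := by omega
  rcases lt_trichotomy (i + j) p with h | h | h
  · have hk : i + j ∈ Finset.Icc 1 (p - 1) := Finset.mem_Icc.2 (by omega)
    simp only [Nat.mod_eq_of_lt h, coneLift, hi, hj, hk, if_true, h, h.ne, h.not_gt, ne_eq,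
      not_false_eq_true, forall_const, false_imp_iff, and_true]
    have := mul_le_mul_iff_right₀ (b := μ (i + j)) (c := μ i + μ j) hp
    rw [mul_add] at this
    omega
  · simp [h]
  · have hk : i + j - p ∈ Finset.Icc 1 (p - 1) := Finset.mem_Icc.2 (by omega)
    have hmod : (i + j) % p = i + j - p := by
      rw [Nat.mod_eq_sub_mod h.le, Nat.mod_eq_of_lt (by omega)]
    simp only [hmod, coneLift, hi, hj, hk, if_true, h, h.ne', h.not_gt, ne_eq,
      not_false_eq_true, forall_const, false_imp_iff, true_and]
    have := mul_le_mul_iff_right₀ (b := μ (i + j - p)) (c := μ i + μ j + 1) hp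
    rw [mul_add, mul_add] at this
    omega

lemma weight_coneLift (p : ℕ) (α μ : ℕ → ℕ) :
    weight p α (coneLift p μ) = p * weight p α μ + ∑ i ∈ Finset.Icc 1 (p - 1), α i * i := by
  simp only [weight_apply, Finset.mul_sum, ← Finset.sum_add_distrib]
  refine Finset.sum_congr rfl fun i hi => ?_
  rw [coneLift, if_pos hi]
  ring

/-- The point with coordinates `c_0 + 1, …, c_{p-2} + 1`. -/
def positivePoint (p : ℕ) (c : Fin (p - 1) → ℕ) : ℕ → ℕ :=
  ∑ i, (c i + 1) • Pi.single (M := fun _ : ℕ => ℕ) ((i : ℕ) + 1) 1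

lemma positivePoint_succ {p : ℕ} (c : Fin (p - 1) → ℕ) (i : Fin (p - 1)) :
    positivePoint p c (i + 1) = c i + 1 := by
  simp only [positivePoint, Finset.sum_apply, Pi.smul_apply, Pi.single_apply, smul_eq_mul]
  rw [Finset.sum_eq_single i]
  · simp
  · intro j _ hj
    simp [Fin.val_inj, hj.symm]
  · simp

lemma positivePoint_eq_coneLift {p : ℕ} {c : Fin (p - 1) → ℕ} {μ : ℕ → ℕ}
    (h : ∀ i : Fin (p - 1), c i = p * μ (i + 1) + i) : positivePoint p c = coneLift p μ := by
  funext k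
  by_cases hk : k ∈ Finset.Icc 1 (p - 1)
  · have hk' := Finset.mem_Icc.1 hk
    obtain ⟨i, rfl⟩ : ∃ i : Fin (p - 1), k = i + 1 := ⟨⟨k - 1, by omega⟩, by simp; omega⟩
    rw [positivePoint_succ, coneLift, if_pos hk, h, add_assoc]
  · rw [coneLift, if_neg hk]
    simp only [positivePoint, Finset.sum_apply, Pi.smul_apply, Pi.single_apply, smul_eq_mul]
    refine Finset.sum_eq_zero fun i _ => ?_
    rw [if_neg, mul_zero]
    rintro rfl
    exact hk (Finset.mem_Icc.2 (by omega))

/-- The points congruent to `(1, …, p - 1)` modulo `p`. -/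
def residueClass (p : ℕ) : Set (ℕ → ℕ) := {x | ∀ i ∈ Finset.Icc 1 (p - 1), x i % p = i}

lemma encard_latticePoints {p : ℕ} (hp : 0 < p) (α : ℕ → ℕ) (n : ℕ) :
    (latticePoints p α n).encard = {c | MemCpStar p (positivePoint p c) ∧
      positivePoint p c ∈ residueClass p ∧ weight p α (positivePoint p c) =
        p * n + ∑ i ∈ Finset.Icc 1 (p - 1), α i * i}.encard := by
  let f : (ℕ → ℕ) → Fin (p - 1) → ℕ := fun μ i => p * μ (i + 1) + i
  have hf : ∀ μ, positivePoint p (f μ) = coneLift p μ := fun μ =>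
    positivePoint_eq_coneLift fun i => rfl
  have hinj : Set.InjOn f (latticePoints p α n) := by
    intro μ hμ ν hν h
    funext k
    by_cases hk : k ∈ Finset.Icc 1 (p - 1)
    · have hk' := Finset.mem_Icc.1 hk
      have := congrFun h ⟨k - 1, by omega⟩
      simpa [f, Nat.sub_add_cancel hk'.1, hp.ne'] using this
    · rw [hμ.1 k hk, hν.1 k hk]
  rw [← hinj.encard_image]
  congr 1
  ext c
  constructor
  · rintro ⟨μ, ⟨-, hμ, hw⟩, rfl⟩
    simp only [Set.mem_ofPred_eq, hf]
    refine ⟨memCpStar_coneLift_iff.2 hμ, fun i hi => ?_, by rw [weight_coneLift, hw]⟩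
    have := Finset.mem_Icc.1 hi
    rw [coneLift, if_pos hi, Nat.mul_add_mod, Nat.mod_eq_of_lt (by omega)]
  · rintro ⟨hc, hres, hw⟩
    let μ : ℕ → ℕ := fun k => if k ∈ Finset.Icc 1 (p - 1) then positivePoint p c k / p else 0
    have hcμ : f μ = c := by
      funext i
      have hi : (i : ℕ) + 1 ∈ Finset.Icc 1 (p - 1) := Finset.mem_Icc.2 (by omega)
      have h1 := hres _ hi
      have h2 := Nat.div_add_mod (positivePoint p c (i + 1)) p
      simp only [f, μ, if_pos hi]
      rw [h1] at h2
      rw [positivePoint_succ] at h2 ⊢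
      omega
    have hpt : positivePoint p c = coneLift p μ := by rw [← hf, hcμ]
    rw [hpt] at hc hw
    rw [weight_coneLift] at hw
    exact ⟨μ, ⟨fun i hi => if_neg hi, memCpStar_coneLift_iff.1 hc,
      Nat.eq_of_mul_eq_mul_left hp (by omega)⟩, hcμ⟩

lemma exists_isQuasiPolynomial_encard_latticePoints {p : ℕ} (hp : 2 ≤ p) (α : ℕ → ℕ)
    (hpos : ∀ μ : ℕ → ℕ, IsTuple p μ → MemCpStar p μ → μ ≠ 0 → 0 < weight p α μ) :
    ∃ (N : ℕ) (f : ℕ → ℕ), 0 < N ∧ IsQuasiPolynomial N (p - 2) (fun n => f n) ∧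
      ∀ n, (latticePoints p α n).encard = f n := by
  classical
  let L₀ : List (ℕ → ℕ) := List.ofFn fun i : Fin (p - 1) => Pi.single ((i : ℕ) + 1) 1
  obtain ⟨τ, _, P, ⟨hlen, hsemi, hdecomp⟩, hnonneg⟩ := exists_isConeSubdivision (coneForms p) L₀
  simp only [forall_coneForms_nonneg_iff] at hdecomp hnonneg
  let A : AddSubsemigroup (ℕ → ℕ) :=
    { carrier := {v | IsTuple p v ∧ v ≠ 0}
      add_mem' := fun {u v} hu hv => ⟨fun i hi => by simp [hu.1 i hi, hv.1 i hi], fun h =>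
        hu.2 (funext fun i => Nat.eq_zero_of_add_eq_zero_right (congrFun h i))⟩ }
  have hA : ∀ t, ∀ v ∈ P t, v ∈ A := hsemi A <| by
    intro v hv
    obtain ⟨i, rfl⟩ := (List.mem_ofFn' _ _).1 hv
    refine ⟨fun k hk => Pi.single_eq_of_ne ?_ _, by simp⟩
    rintro rfl
    exact hk (Finset.mem_Icc.2 (by omega))
  have hw : ∀ t, ∀ v ∈ P t, 0 < weight p α v := fun t v hv =>
    hpos v (hA t v hv).1 (hnonneg t v hv) (hA t v hv).2
  let W := ∏ t, ((P t).map (weight p α)).prod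
  have hW : 0 < W := Finset.prod_pos fun t _ => List.prod_pos fun a ha => by
    obtain ⟨v, hv, rfl⟩ := List.mem_map.1 ha
    exact hw t v hv
  have hN : 0 < p * W := by positivity
  have hdvd : ∀ t, ∀ v ∈ P t, ∃ n, 0 < n ∧ p ∣ n ∧ n * weight p α v = p * W := by
    intro t v hv
    obtain ⟨q, hq⟩ : weight p α v ∣ W :=
      (List.dvd_prod (List.mem_map_of_mem hv)).trans (Finset.dvd_prod_of_mem _ (Finset.mem_univ t))
    refine ⟨p * q, ?_, dvd_mul_right p q, by rw [hq]; ring⟩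
    have : 0 < q := Nat.pos_of_ne_zero fun h => by simp [h] at hq; omega
    positivity
  choose σ hσ x hx hsum using fun t =>
    exists_openConeSum_eq_sum_multichooseCount (weight p α) (p := p) hN (P t) (hdvd t)
  let G : (ℕ → ℕ) → ℕ := (residueClass p).indicator 1
  have hG : ∀ x y, G (x + p • y) = G x := fun x y => by
    simp [G, Set.indicator_apply, residueClass]
  let g : ℕ → ℕ := fun m => ∑ t, ∑ s, G (x t s) *
    multichooseCount (p * W) (P t).length m (weight p α (x t s))
  have hg : IsQuasiPolynomial (p * W) (p - 2) fun m => g m := by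
    simp only [g, Nat.cast_sum, Nat.cast_mul]
    refine .sum fun t => .sum fun s => ?_
    obtain ⟨h₁, h₂⟩ := hx t s
    rcases h₁.lt_or_eq with h | h
    · refine .const_mul _ (.multichooseCount hN ?_ h)
      have := hlen t
      simp only [L₀, List.length_ofFn] at this
      omega
    · obtain ⟨y, hy⟩ := h₂ h
      have : G (x t s) = 0 := by
        refine Set.indicator_of_notMem (fun hmem => ?_) _
        have := hmem 1 (Finset.mem_Icc.2 (by omega))
        simp [hy] at this
      simp only [this, Nat.cast_zero, zero_mul]
      exact .zero
  refine ⟨p * W, fun n => g (p * n + ∑ i ∈ Finset.Icc 1 (p - 1), α i * i), hN,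
    hg.comp_linear _ _, fun n => ?_⟩
  rw [encard_latticePoints (by omega)]
  dsimp only
  generalize p * n + ∑ i ∈ Finset.Icc 1 (p - 1), α i * i = m
  have key := hdecomp fun x => if weight p α x = m then (G x : ℝ≥0∞) else 0
  have hright : ∀ t, openConeSum (P t) (fun x => if weight p α x = m then (G x : ℝ≥0∞) else 0) =
      ∑ s, (G (x t s) : ℝ≥0∞) *
        multichooseCount (p * W) (P t).length m (weight p α (x t s)) := fun t => by
    simpa using hsum t G hG m 0
  simp only [hright] at key
  rw [openConeSum_ofFn] at key
  have hcount : ∀ S : Set (Fin (p - 1) → ℕ),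
      ∑' c, S.indicator (fun _ => (1 : ℝ≥0∞)) c = S.encard := fun S => by
    rw [← tsum_subtype, ENNReal.tsum_set_one]
  have hleft := hcount {c | MemCpStar p (positivePoint p c) ∧
      positivePoint p c ∈ residueClass p ∧ weight p α (positivePoint p c) = m}
  have : ((({c | MemCpStar p (positivePoint p c) ∧
      positivePoint p c ∈ residueClass p ∧ weight p α (positivePoint p c) = m}.encard : ℕ∞)) :
        ℝ≥0∞) = ((g m : ℕ∞) : ℝ≥0∞) := by
    rw [← hleft, ENat.toENNReal_coe]
    simp only [g, Nat.cast_sum, Nat.cast_mul]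
    rw [← key]
    refine tsum_congr fun c => ?_
    change _ = Set.indicator _ _ (positivePoint p c)
    by_cases h₁ : MemCpStar p (positivePoint p c) <;>
    by_cases h₂ : positivePoint p c ∈ residueClass p <;>
    by_cases h₃ : weight p α (positivePoint p c) = m <;>
    simp [Set.indicator_apply, h₁, h₂, h₃, G]
  exact_mod_cast this

lemma card_box_le_sum_ncard_latticePoints {p : ℕ} {α : ℕ → ℕ}
    (hfin : ∀ n, (latticePoints p α n).Finite) (t : ℕ) :
    (t + 1) ^ (p - 1) ≤ ∑ n ∈ Finset.range (2 * t * ∑ i ∈ Finset.Icc 1 (p - 1), α i + 1),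
      (latticePoints p α n).ncard := by
  classical
  let box : Finset (Fin (p - 1) → ℕ) := Fintype.piFinset fun _ => Finset.Icc t (2 * t)
  let e : (Fin (p - 1) → ℕ) → ℕ → ℕ := fun c k =>
    if h : k ∈ Finset.Icc 1 (p - 1) then
      c ⟨k - 1, by have := Finset.mem_Icc.1 h; omega⟩ else 0
  have he : Function.Injective e := by
    intro c d h
    funext i
    have := congrFun h (i + 1)
    have hi : (i : ℕ) + 1 ∈ Finset.Icc 1 (p - 1) := Finset.mem_Icc.2 (by omega)
    simpa only [e, dif_pos hi, Nat.add_sub_cancel] using this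
  have hbounds : ∀ c ∈ box, ∀ k ∈ Finset.Icc 1 (p - 1), t ≤ e c k ∧ e c k ≤ 2 * t := by
    intro c hc k hk
    simp only [e, dif_pos hk]
    exact Finset.mem_Icc.1 (Fintype.mem_piFinset.1 hc _)
  have hcard : box.card = (t + 1) ^ (p - 1) := by
    simp [box, Fintype.card_piFinset, show 2 * t + 1 - t = t + 1 by omega]
  rw [← hcard, Finset.card_eq_sum_card_fiberwise (f := fun c => weight p α (e c))
    (t := Finset.range (2 * t * ∑ i ∈ Finset.Icc 1 (p - 1), α i + 1))]
  · refine Finset.sum_le_sum fun n _ => ?_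
    rw [← Set.ncard_coe_finset]
    refine Set.ncard_le_ncard_of_injOn e (fun c hc => ?_) he.injOn (hfin n)
    obtain ⟨hc, hn⟩ := Finset.mem_filter.1 (Finset.mem_coe.1 hc)
    refine ⟨fun k hk => dif_neg hk, fun i hi j hj => ?_, hn⟩
    have h₁ := hbounds c hc i hi
    have h₂ := hbounds c hc j hj
    have hi' := Finset.mem_Icc.1 hi
    have hj' := Finset.mem_Icc.1 hj
    constructor
    · intro h
      have := hbounds c hc (i + j) (Finset.mem_Icc.2 (by omega))
      omega
    · intro h
      have := hbounds c hc (i + j - p) (Finset.mem_Icc.2 (by omega))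
      omega
  · intro c hc
    simp only [Finset.coe_range, Set.mem_Iio, Nat.lt_succ_iff, weight_apply, Finset.mul_sum]
    refine Finset.sum_le_sum fun i hi => ?_
    rw [mul_comm]
    exact Nat.mul_le_mul_right _ (hbounds c hc i hi).2

lemma Polynomial.exists_forall_eval_natCast_le {P : ℝ[X]} {D : ℕ} (hP : P.natDegree ≤ D) :
    ∃ K : ℝ, 0 ≤ K ∧ ∀ n : ℕ, P.eval (n : ℝ) ≤ K * ((n : ℝ) + 1) ^ D := by
  refine ⟨∑ i ∈ Finset.range (D + 1), |P.coeff i|, Finset.sum_nonneg fun _ _ => abs_nonneg _,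
    fun n => ?_⟩
  rw [Polynomial.eval_eq_sum_range' (Nat.lt_succ_iff.2 hP), Finset.sum_mul]
  refine Finset.sum_le_sum fun i hi => ?_
  have hn : (0 : ℝ) ≤ n := n.cast_nonneg
  have hi : i ≤ D := Nat.lt_succ_iff.1 (Finset.mem_range.1 hi)
  calc P.coeff i * (n : ℝ) ^ i ≤ |P.coeff i| * ((n : ℝ) + 1) ^ i := by
        gcongr
        · exact le_abs_self _
        · linarith
    _ ≤ _ := by
        gcongr
        linarith

lemma Polynomial.coeff_nonneg_of_frequently_eval_nonneg {P : ℝ[X]} {D : ℕ} (hD : 0 < D)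
    (hP : P.natDegree ≤ D) (h : ∃ᶠ x in Filter.atTop, 0 ≤ P.eval x) : 0 ≤ P.coeff D := by
  by_contra! hneg
  have hdeg : P.natDegree = D :=
    hP.antisymm (Polynomial.le_natDegree_of_ne_zero hneg.ne)
  have hlim := P.tendsto_atBot_of_leadingCoeff_nonpos
    (Polynomial.natDegree_pos_iff_degree_pos.1 (by omega))
    (by rw [Polynomial.leadingCoeff, hdeg]; exact hneg.le)
  exact h ((hlim.eventually_lt_atBot 0).mono fun x hx => not_le.2 hx)

/-- A function bounded on all of `ℕ` by a multiple of `(n + 1) ^ D` has partial sums of order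
at most `D + 1`. -/
lemma exists_pow_gt_sum_range {f : ℕ → ℕ} {D : ℕ} {K : ℝ}
    (hf : ∀ n, (f n : ℝ) ≤ K * ((n : ℝ) + 1) ^ D) (hK : 0 ≤ K) {s : ℕ} (hs : 0 < s) :
    ∃ t : ℕ, ∑ n ∈ Finset.range (2 * t * s + 1), f n < (t + 1) ^ (D + 2) := by
  obtain ⟨t, ht⟩ := exists_nat_gt (K * (2 * s) ^ (D + 1))
  refine ⟨t, ?_⟩
  rw [← Nat.cast_lt (α := ℝ)]
  have hM : ((2 * t * s + 1 : ℕ) : ℝ) ≤ 2 * s * (t + 1) := by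
    have : (2 * t * s + 1 : ℕ) ≤ 2 * s * (t + 1) := by nlinarith
    exact_mod_cast this
  calc ((∑ n ∈ Finset.range (2 * t * s + 1), f n : ℕ) : ℝ)
      ≤ ∑ n ∈ Finset.range (2 * t * s + 1), K * ((2 * t * s + 1 : ℕ) : ℝ) ^ D := by
        rw [Nat.cast_sum]
        refine Finset.sum_le_sum fun n hn => (hf n).trans ?_
        have : ((n : ℝ) + 1) ≤ ((2 * t * s + 1 : ℕ) : ℝ) := by
          exact_mod_cast Finset.mem_range.1 hn
        gcongr
    _ = K * ((2 * t * s + 1 : ℕ) : ℝ) ^ (D + 1) := by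
        rw [Finset.sum_const, Finset.card_range, nsmul_eq_mul]; ring
    _ ≤ K * (2 * s * (t + 1)) ^ (D + 1) := by gcongr
    _ = K * (2 * s) ^ (D + 1) * ((t : ℝ) + 1) ^ (D + 1) := by rw [mul_pow]; ring
    _ < ((t : ℝ) + 1) * ((t : ℝ) + 1) ^ (D + 1) := by
        gcongr
        linarith
    _ = (((t + 1) ^ (D + 2) : ℕ) : ℝ) := by push_cast; ring

/-- If `α ∈ ℕ^{p-1}` is primitive and `α ⬝ μ > 0` for every nonzero lattice point `μ`
of `C_p^*`, then `n ↦ #(C_p ∩ {α ⬝ x = n} ∩ ℕ^{p-1})` is a quasi-polynomial of degree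
`p - 2` with non-negative leading coefficients. -/
theorem latticeCount_quasiPolynomial
    (p : ℕ) (hp : 3 ≤ p) (α : ℕ → ℕ) (hα : IsTuple p α)
    (hgcd : (Finset.Icc 1 (p - 1)).gcd α = 1)
    (hpos : ∀ μ : ℕ → ℕ, IsTuple p μ → MemCpStar p μ → μ ≠ 0 →
      0 < ∑ i ∈ Finset.Icc 1 (p - 1), α i * μ i) :
    ∃ (N : ℕ) (c : ℕ → Polynomial ℝ), 0 < N ∧
      (∀ i < N, (c i).degree ≤ ((p - 2 : ℕ) : WithBot ℕ)) ∧
      (∃ i < N, (c i).degree = ((p - 2 : ℕ) : WithBot ℕ)) ∧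
      (∀ i < N, 0 ≤ (c i).coeff (p - 2)) ∧
      (∀ n : ℕ, (latticeCount p α n : ℝ) = (c (n % N)).eval (n : ℝ)) := by
  obtain ⟨N, f, hN, ⟨c, hc, hf⟩, hcount⟩ :=
    exists_isQuasiPolynomial_encard_latticePoints (by omega) α hpos
  replace hf : ∀ n, (f n : ℝ) = (c (n % N)).eval (n : ℝ) := hf
  have hfin : ∀ n, (latticePoints p α n).Finite := fun n =>
    Set.finite_of_encard_eq_coe (hcount n)
  have hncard : ∀ n, (latticePoints p α n).ncard = f n := fun n => by
    rw [Set.ncard, hcount, ENat.toNat_natCast]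
  have hdeg : ∀ i, (c i).degree ≤ ((p - 2 : ℕ) : WithBot ℕ) := fun i =>
    Polynomial.natDegree_le_iff_degree_le.1 (hc i)
  refine ⟨N, c, hN, fun i _ => hdeg i, ?_, fun i hi => ?_, fun n => ?_⟩
  · by_contra! hne
    have hlt : ∀ i < N, (c i).natDegree ≤ p - 3 := fun i hi => by
      have := (hdeg i).lt_of_ne (hne i hi)
      rw [Polynomial.degree_lt_iff_coeff_zero] at this
      exact Polynomial.natDegree_le_iff_coeff_eq_zero.2 fun k hk => this k (by omega)
    choose! K hK₀ hK using fun i hi => Polynomial.exists_forall_eval_natCast_le (hlt i hi)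
    have hs : 0 < ∑ i ∈ Finset.Icc 1 (p - 1), α i := by
      refine Nat.pos_of_ne_zero fun h => ?_
      rw [Finset.gcd_eq_zero_iff.2 (Finset.sum_eq_zero_iff.1 h)] at hgcd
      exact zero_ne_one hgcd
    obtain ⟨t, ht⟩ := exists_pow_gt_sum_range (f := f) (D := p - 3)
      (K := ∑ i ∈ Finset.range N, K i) (fun n => by
        have hn := Nat.mod_lt n hN
        rw [hf]
        refine (hK _ hn n).trans ?_
        gcongr
        exact Finset.single_le_sum (f := K) (fun i hi => hK₀ i (Finset.mem_range.1 hi))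
          (Finset.mem_range.2 hn))
      (Finset.sum_nonneg fun i hi => hK₀ i (Finset.mem_range.1 hi)) hs
    have hbox := card_box_le_sum_ncard_latticePoints hfin t
    simp only [hncard] at hbox
    rw [show p - 3 + 2 = p - 1 by omega] at ht
    omega
  · refine Polynomial.coeff_nonneg_of_frequently_eval_nonneg (by omega) (hc i) ?_
    rw [Filter.frequently_atTop]
    intro a
    obtain ⟨k, hk⟩ := exists_nat_ge a
    refine ⟨((i + N * k : ℕ) : ℝ), hk.trans ?_, ?_⟩
    · exact_mod_cast (Nat.le_mul_of_pos_left k hN).trans (Nat.le_add_left _ _)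
    · have := hf (i + N * k)
      rw [Nat.add_mul_mod_self_left, Nat.mod_eq_of_lt hi] at this
      rw [← this]
      exact Nat.cast_nonneg _
  · rw [← hf, ← hncard]
    rfl
end

section
/- Let p ≥ 3 be an integer and let α = (α_1,…,α_{p−1}) ∈ ℕ^{p−1} have gcd(α_1,…,α_{p−1}) = 1. Assume that Σ_{i=1}^{p−1} α_i·μ_i > 0 for every nonzero μ ∈ ℕ^{p−1} satisfying μ_i + μ_j ≥ μ_{(i+j mod p)} for all 1 ≤ i,j ≤ p−1 with i + j ≢ 0 (mod p). Define f_α(n) = #{μ ∈ ℕ^{p−1} : μ_i + μ_j ≥ μ_{i+j} whenever i+j < p, μ_i + μ_j ≥ μ_{i+j−p} − 1 whenever i+j > p, and Σ α_i·μ_i = n} and f⁰_α(n) = #{μ ∈ ℕ^{p−1} : μ_i + μ_j > μ_{i+j} whenever i+j < p, μ_i + μ_j ≥ μ_{i+j−p} whenever i+j > p, and Σ α_i·μ_i = n}. Then for every n ≥ Σ_{i=1}^{p−1} α_i one has f⁰_α(n) = f_α(n − Σ_{i=1}^{p−1} α_i). -/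
/-- Membership in the interior of the cone `C_p`: `μ_i + μ_j > μ_{i+j}` whenever
`i + j < p`, and `μ_i + μ_j ≥ μ_{i+j-p}` whenever `i + j > p`. -/
def MemCpInterior (p : ℕ) (μ : ℕ → ℕ) : Prop :=
  ∀ i ∈ Finset.Icc 1 (p - 1), ∀ j ∈ Finset.Icc 1 (p - 1),
    (i + j < p → μ (i + j) < μ i + μ j) ∧
    (p < i + j → μ (i + j - p) ≤ μ i + μ j)

/-- The number of lattice points of the interior of `C_p` on the hyperplane `α ⬝ x = n`. -/
noncomputable def latticeCountInterior (p : ℕ) (α : ℕ → ℕ) (n : ℕ) : ℕ :=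
  {μ : ℕ → ℕ | IsTuple p μ ∧ MemCpInterior p μ ∧
    ∑ i ∈ Finset.Icc 1 (p - 1), α i * μ i = n}.ncard

/-- Every coordinate of a lattice point in the interior of `C_p` is positive. -/
theorem MemCpInterior.pos {p : ℕ} (hp : 3 ≤ p) {μ : ℕ → ℕ} (h : MemCpInterior p μ) :
    ∀ i ∈ Finset.Icc 1 (p - 1), 0 < μ i := by
  intro i
  induction i using Nat.strong_induction_on with
  | _ i ih =>
    intro hi
    by_contra hμ
    have hii := h i hi i hi
    rw [Finset.mem_Icc] at hi
    rcases lt_trichotomy (i + i) p with hlt | heq | hgt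
    · have := hii.1 hlt
      omega
    · have h₁ := (h i (by simp; omega) 1 (by simp; omega)).1 (by omega)
      have h₂ := (h i (by simp; omega) (i + 1) (by simp; omega)).2 (by omega)
      rw [show i + (i + 1) - p = 1 by omega] at h₂
      omega
    · have h₁ := hii.2 hgt
      have h₂ := ih (i + i - p) (by omega) (by simp; omega)
      omega

/-- Translation by the vector `(1,…,1)` of `ℕ^{p-1}`. -/
def addOnes (p : ℕ) (μ : ℕ → ℕ) : ℕ → ℕ :=
  fun i => if i ∈ Finset.Icc 1 (p - 1) then μ i + 1 else 0

theorem addOnes_apply {p i : ℕ} (μ : ℕ → ℕ) (hi : i ∈ Finset.Icc 1 (p - 1)) :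
    addOnes p μ i = μ i + 1 := if_pos hi

theorem isTuple_addOnes (p : ℕ) (μ : ℕ → ℕ) : IsTuple p (addOnes p μ) :=
  fun _ hi => if_neg hi

theorem addOnes_injOn (p : ℕ) : Set.InjOn (addOnes p) {μ | IsTuple p μ} := by
  intro μ hμ ν hν h
  ext i
  by_cases hi : i ∈ Finset.Icc 1 (p - 1)
  · have := congrFun h i
    rw [addOnes_apply μ hi, addOnes_apply ν hi] at this
    omega
  · rw [hμ i hi, hν i hi]

theorem memCpInterior_addOnes {p : ℕ} {μ : ℕ → ℕ} :
    MemCpInterior p (addOnes p μ) ↔ MemCp p μ := by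
  refine forall₂_congr fun i hi => forall₂_congr fun j hj =>
    and_congr (forall_congr' fun hij => ?_) (forall_congr' fun hij => ?_)
  · have hk : i + j ∈ Finset.Icc 1 (p - 1) := by
      rw [Finset.mem_Icc] at *
      omega
    rw [addOnes_apply μ hi, addOnes_apply μ hj, addOnes_apply μ hk]
    omega
  · have hk : i + j - p ∈ Finset.Icc 1 (p - 1) := by
      rw [Finset.mem_Icc] at *
      omega
    rw [addOnes_apply μ hi, addOnes_apply μ hj, addOnes_apply μ hk]
    omega

theorem sum_mul_addOnes (p : ℕ) (α μ : ℕ → ℕ) :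
    ∑ i ∈ Finset.Icc 1 (p - 1), α i * addOnes p μ i =
      ∑ i ∈ Finset.Icc 1 (p - 1), α i * μ i + ∑ i ∈ Finset.Icc 1 (p - 1), α i := by
  rw [← Finset.sum_add_distrib]
  refine Finset.sum_congr rfl fun i hi => ?_
  rw [addOnes_apply μ hi, mul_add_one]

/-- A tuple with positive coordinates is a translate by `(1,…,1)`. -/
theorem IsTuple.exists_addOnes_eq {p : ℕ} {μ : ℕ → ℕ} (hμ : IsTuple p μ)
    (hpos : ∀ i ∈ Finset.Icc 1 (p - 1), 0 < μ i) :
    ∃ ν, IsTuple p ν ∧ addOnes p ν = μ := by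
  refine ⟨fun i => μ i - 1, fun i hi => by simp [hμ i hi], ?_⟩
  ext i
  by_cases hi : i ∈ Finset.Icc 1 (p - 1)
  · rw [addOnes_apply _ hi, Nat.sub_add_cancel (hpos i hi)]
  · rw [isTuple_addOnes p _ i hi, hμ i hi]

/-- For `n ≥ Σ α_i` one has `f⁰_α(n) = f_α(n - Σ α_i)`. -/
theorem latticeCountInterior_eq_latticeCount
    (p : ℕ) (hp : 3 ≤ p) (α : ℕ → ℕ) (hα : IsTuple p α)
    (hgcd : (Finset.Icc 1 (p - 1)).gcd α = 1)
    (hpos : ∀ μ : ℕ → ℕ, IsTuple p μ → MemCpStar p μ → μ ≠ 0 →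
      0 < ∑ i ∈ Finset.Icc 1 (p - 1), α i * μ i)
    (n : ℕ) (hn : ∑ i ∈ Finset.Icc 1 (p - 1), α i ≤ n) :
    latticeCountInterior p α n = latticeCount p α (n - ∑ i ∈ Finset.Icc 1 (p - 1), α i) := by
  unfold latticeCountInterior latticeCount
  symm
  rw [← Set.InjOn.ncard_image ((addOnes_injOn p).mono fun μ hμ => hμ.1)]
  congr 1
  ext μ
  constructor
  · rintro ⟨ν, ⟨-, hmem, hsum⟩, rfl⟩
    refine ⟨isTuple_addOnes p ν, memCpInterior_addOnes.2 hmem, ?_⟩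
    rw [sum_mul_addOnes]
    omega
  · rintro ⟨hμ, hint, hsum⟩
    obtain ⟨ν, hν, rfl⟩ := hμ.exists_addOnes_eq (hint.pos hp)
    rw [sum_mul_addOnes] at hsum
    exact ⟨ν, ⟨hν, memCpInterior_addOnes.1 hint, by omega⟩, rfl⟩
end

section
/- Let p ≥ 3 be an integer and for g ∈ ℕ let G(p,g) denote the number of numerical semigroups H with p ∈ H and genus g(H) = g. Then g ↦ G(p,g) is a quasi-polynomial of degree p−2, and the coefficient of T^{p−2} in each of its constituent polynomials is non-negative. -/
/-- `G p g`: the number of numerical semigroups containing `p` of genus `g`. -/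
noncomputable def countGenus (p g : ℕ) : ℕ :=
  {H : Set ℕ | IsNumericalSemigroup H ∧ p ∈ H ∧ genus H = g}.ncard

/-- `f` is a quasi-polynomial on the positive integers: along every arithmetic progression of a
suitable common difference which starts at a positive integer, `f` is polynomial. -/
def IsQuasiPoly (f : ℕ → ℝ) : Prop :=
  ∃ N : ℕ, 0 < N ∧ ∀ r : ℕ, 0 < r → ∃ P : Polynomial ℝ, ∀ k : ℕ, f (r + N * k) = P.eval (k : ℝ)

namespace IsQuasiPoly

open Polynomial

lemma congr {f g : ℕ → ℝ} (hf : IsQuasiPoly f) (h : ∀ n, 0 < n → g n = f n) : IsQuasiPoly g := by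
  obtain ⟨N, hN, H⟩ := hf
  refine ⟨N, hN, fun r hr => ?_⟩
  obtain ⟨P, hP⟩ := H r hr
  exact ⟨P, fun k => by rw [h _ (by omega), hP]⟩

lemma zero : IsQuasiPoly (fun _ => 0) :=
  ⟨1, one_pos, fun _ _ => ⟨0, fun _ => by simp⟩⟩

lemma add {f g : ℕ → ℝ} (hf : IsQuasiPoly f) (hg : IsQuasiPoly g) :
    IsQuasiPoly (fun n => f n + g n) := by
  obtain ⟨N, hN, H⟩ := hf
  obtain ⟨M, hM, K⟩ := hg
  refine ⟨N * M, Nat.mul_pos hN hM, fun r hr => ?_⟩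
  obtain ⟨P, hP⟩ := H r hr
  obtain ⟨Q, hQ⟩ := K r hr
  refine ⟨P.comp (C (M : ℝ) * X) + Q.comp (C (N : ℝ) * X), fun k => ?_⟩
  have h1 := hP (M * k)
  have h2 := hQ (N * k)
  push_cast at h1 h2
  rw [← mul_assoc] at h1 h2
  rw [mul_comm M N] at h2
  simp [h1, h2]

lemma sum {ι : Type*} (s : Finset ι) {f : ι → ℕ → ℝ} (hf : ∀ i ∈ s, IsQuasiPoly (f i)) :
    IsQuasiPoly (fun n => ∑ i ∈ s, f i n) := by
  classical
  induction s using Finset.induction_on with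
  | empty => simpa using zero
  | insert a s ha ih =>
    simp only [Finset.sum_insert ha]
    exact (hf a (by simp)).add (ih fun i hi => hf i (by simp [hi]))

lemma shift {f : ℕ → ℝ} (hf : IsQuasiPoly f) (a : ℕ) : IsQuasiPoly (fun n => f (n + a)) := by
  obtain ⟨N, hN, H⟩ := hf
  refine ⟨N, hN, fun r hr => ?_⟩
  obtain ⟨P, hP⟩ := H (r + a) (by omega)
  exact ⟨P, fun k => by rw [← hP]; exact congrArg f (by ring)⟩

lemma exists_eval_eq_sum_range (R : ℝ[X]) :
    ∃ P : ℝ[X], ∀ k : ℕ, P.eval (k : ℝ) = ∑ i ∈ Finset.range k, R.eval (i : ℝ) := by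
  induction R using Polynomial.induction_on' with
  | add p q hp hq =>
    obtain ⟨P, hP⟩ := hp
    obtain ⟨Q, hQ⟩ := hq
    exact ⟨P + Q, fun k => by simp [hP, hQ, Finset.sum_add_distrib]⟩
  | monomial n a =>
    refine ⟨C (a / (n + 1)) * ((Polynomial.bernoulli n.succ).map (algebraMap ℚ ℝ) -
      C (_root_.bernoulli n.succ : ℝ)), fun k => ?_⟩
    have h := Polynomial.sum_range_pow_eq_bernoulli_sub k n
    have h' : ((n : ℝ) + 1) * ∑ i ∈ Finset.range k, (i : ℝ) ^ n =
        ((Polynomial.bernoulli n.succ).map (algebraMap ℚ ℝ)).eval (k : ℝ) -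
          (_root_.bernoulli n.succ : ℝ) := by
      have e : ((Polynomial.bernoulli n.succ).map (algebraMap ℚ ℝ)).eval (k : ℝ) =
          (((Polynomial.bernoulli n.succ).eval (k : ℚ) : ℚ) : ℝ) := by
        rw [Polynomial.eval_map_algebraMap]
        have := Polynomial.aeval_algebraMap_apply ℝ (k : ℚ) (Polynomial.bernoulli n.succ)
        simpa using this
      rw [e]
      exact_mod_cast h
    have hn : (n : ℝ) + 1 ≠ 0 := by positivity
    simp only [eval_mul, eval_C, eval_sub, eval_monomial]
    rw [← h', ← Finset.mul_sum]
    field_simp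

lemma of_difference {f q : ℕ → ℝ} (hq : IsQuasiPoly q) {a : ℕ} (ha : 0 < a)
    (h : ∀ n, 0 < n → f (n + a) = f n + q n) : IsQuasiPoly f := by
  obtain ⟨N, hN, H⟩ := hq
  refine ⟨N * a, Nat.mul_pos hN ha, fun r hr => ?_⟩
  have key : ∀ m j : ℕ, 0 < m → f (m + a * j) = f m + ∑ i ∈ Finset.range j, q (m + a * i) := by
    intro m j hm
    induction j with
    | zero => simp
    | succ j ih =>
      rw [Finset.sum_range_succ, ← add_assoc, ← ih, ← h _ (by omega)]
      congr 1; ring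
  choose! P hP using fun j : ℕ => H (r + a * j) (by omega)
  obtain ⟨Q, hQ⟩ := exists_eval_eq_sum_range
    (∑ j ∈ Finset.range N, (P j).comp (C (a : ℝ) * X))
  refine ⟨C (f r) + Q, fun k => ?_⟩
  rw [eval_add, eval_C, hQ]
  induction k with
  | zero => simp
  | succ k ih =>
    rw [Finset.sum_range_succ, ← add_assoc, ← ih]
    have e : r + N * a * (k + 1) = (r + N * a * k) + a * N := by ring
    rw [e, key _ _ (by omega), eval_finsetSum]
    congr 1
    refine Finset.sum_congr rfl fun j _ => ?_
    have := hP j (a * k)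
    rw [eval_comp, eval_mul, eval_C, eval_X]
    push_cast at this
    rw [← this]
    congr 1; ring

end IsQuasiPoly

/-- Elliott's subdivision procedure: to prove a property of all finite families of vectors, it
suffices to treat those lying on one side of a given hyperplane, provided that the property is
inherited from the three parts in which a pair `v, w` is subdivided by `v + w`. -/
lemma elliott_induction {M : Type*} [AddCommMonoid M] {Q : Multiset M → Prop}
    (subdivide : ∀ v w V, Q (v ::ₘ (v + w) ::ₘ V) → Q ((v + w) ::ₘ V) →
      Q (w ::ₘ (v + w) ::ₘ V) → Q (v ::ₘ w ::ₘ V)) (l : M →+ ℤ)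
    (nonneg : ∀ V : Multiset M, (∀ v ∈ V, 0 ≤ l v) → Q V)
    (nonpos : ∀ V : Multiset M, (∀ v ∈ V, l v ≤ 0) → Q V) (V : Multiset M) : Q V := by
  classical
  have step : ∀ (m c : ℕ) (l : M →+ ℤ), (∀ V : Multiset M, (∀ v ∈ V, 0 ≤ l v) → Q V) →
      (∀ V : Multiset M, (∀ v ∈ V, |l v| ≤ m + 1) →
        V.countP (fun v => |l v| = m + 1) ≤ c → Q V) →
      ∀ v₀, l v₀ = m + 1 → ∀ (b : ℕ) (W : Multiset M), (∀ v ∈ W, |l v| ≤ m + 1) →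
        W.countP (fun v => |l v| = m + 1) ≤ c → W.countP (fun v => l v < 0) ≤ b →
        Q (v₀ ::ₘ W) := by
    intro m c l hl ih v₀ hv₀ b
    induction b with
    | zero =>
      intro W _ _ hb
      refine hl _ fun v hv => ?_
      rcases Multiset.mem_cons.1 hv with rfl | hv
      · omega
      · have := Multiset.countP_eq_zero.1 (Nat.le_zero.1 hb) v hv
        omega
    | succ b ihb =>
      intro W hW hc hb
      by_cases hneg : ∃ w ∈ W, l w < 0
      · obtain ⟨w, hw, hlw⟩ := hneg
        obtain ⟨U, rfl⟩ := Multiset.exists_cons_of_mem hw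
        have hw' := hW w (by simp)
        have hU : ∀ v ∈ U, |l v| ≤ m + 1 := fun v hv => hW v (by simp [hv])
        rw [abs_le] at hw'
        have hs : l (v₀ + w) = m + 1 + l w := by rw [map_add, hv₀]
        have hs0 : 0 ≤ l (v₀ + w) := by omega
        have hs1 : |l (v₀ + w)| ≤ m := by rw [abs_of_nonneg hs0]; omega
        have hs2 : ¬ |l (v₀ + w)| = m + 1 := by omega
        rw [Multiset.countP_cons] at hc hb
        rw [if_pos hlw] at hb
        refine subdivide v₀ w U (ihb _ ?_ ?_ ?_) (ih _ ?_ ?_) (ih _ ?_ ?_)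
        · intro v hv
          rcases Multiset.mem_cons.1 hv with rfl | hv
          · omega
          · exact hU v hv
        · rw [Multiset.countP_cons, if_neg hs2]; omega
        · rw [Multiset.countP_cons, if_neg (by omega)]; omega
        · intro v hv
          rcases Multiset.mem_cons.1 hv with rfl | hv
          · omega
          · exact hU v hv
        · rw [Multiset.countP_cons, if_neg hs2]; omega
        · intro v hv
          rcases Multiset.mem_cons.1 hv with rfl | hv
          · exact hW v (by simp)
          rcases Multiset.mem_cons.1 hv with rfl | hv
          · omega
          · exact hU v hv
        · rw [Multiset.countP_cons, Multiset.countP_cons, if_neg hs2]; omega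
      · push Not at hneg
        refine hl _ fun v hv => ?_
        rcases Multiset.mem_cons.1 hv with rfl | hv
        · omega
        · exact hneg v hv
  have main : ∀ (m : ℕ) (V : Multiset M), (∀ v ∈ V, |l v| ≤ m) → Q V := by
    intro m
    induction m with
    | zero =>
      refine fun V hV => nonneg V fun v hv => ?_
      have := neg_abs_le (l v)
      have := hV v hv
      omega
    | succ m ihm =>
      suffices H : ∀ (c : ℕ) (V : Multiset M), (∀ v ∈ V, |l v| ≤ m + 1) →
          V.countP (fun v => |l v| = m + 1) ≤ c → Q V from
        fun V hV => H _ V (by simpa using hV) le_rfl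
      intro c
      induction c with
      | zero =>
        intro V hV hc
        refine ihm V fun v hv => ?_
        have h1 := hV v hv
        have h2 := Multiset.countP_eq_zero.1 (Nat.le_zero.1 hc) v hv
        omega
      | succ c ihc =>
        intro V hV hc
        by_cases hex : ∃ v ∈ V, |l v| = m + 1
        · obtain ⟨v, hv, hlv⟩ := hex
          obtain ⟨W, rfl⟩ := Multiset.exists_cons_of_mem hv
          have hW : ∀ v ∈ W, |l v| ≤ m + 1 := fun v hv => hV v (by simp [hv])
          rw [Multiset.countP_cons, if_pos hlv] at hc
          rcases abs_choice (l v) with h | h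
          · exact step m c l nonneg ihc v (by omega) _ W hW (by omega) le_rfl
          · refine step m c (-l) (fun V hV => nonpos V fun v hv => ?_) (fun V hV hc => ?_) v ?_ _ W
              ?_ ?_ le_rfl
            · simpa using hV v hv
            · exact ihc V (by simpa using hV) (by simpa using hc)
            · rw [AddMonoidHom.neg_apply]; omega
            · simpa using hW
            · simp only [AddMonoidHom.neg_apply, abs_neg]; omega
        · push Not at hex
          refine ihm V fun v hv => ?_
          have h1 := hV v hv
          have h2 := hex v hv
          omega
  refine main (V.map fun v => (l v).natAbs).sum V fun v hv => ?_
  have := Multiset.le_sum_of_mem (Multiset.mem_map_of_mem (fun v => (l v).natAbs) hv)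
  rw [Int.abs_eq_natAbs]
  exact_mod_cast this

section Elliott

open MvPowerSeries

variable {σ : Type*}

/-- The power series `∑_{k ≥ 1} X ^ (k v)`. -/
noncomputable def openRay (v : σ →₀ ℕ) : MvPowerSeries σ ℝ := by
  classical exact fun y => if ∃ k : ℕ, y = (k + 1) • v then 1 else 0

open Classical in
lemma coeff_openRay (v y : σ →₀ ℕ) :
    coeff y (openRay v) = if ∃ k : ℕ, y = (k + 1) • v then 1 else 0 := rfl

lemma one_sub_monomial_mul_openRay {v : σ →₀ ℕ} (hv : v ≠ 0) :
    (1 - monomial v (1 : ℝ)) * openRay v = monomial v 1 := by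
  classical
  ext y
  rw [sub_mul, one_mul, map_sub, coeff_monomial_mul, one_mul, coeff_openRay, coeff_openRay,
    coeff_monomial]
  by_cases hy : y = v
  · subst hy
    have h1 : ∃ k : ℕ, y = (k + 1) • y := ⟨0, by simp⟩
    have h2 : ¬ ∃ k : ℕ, y - y = (k + 1) • y := by
      rintro ⟨k, hk⟩
      rw [tsub_self] at hk
      exact hv ((smul_eq_zero.1 hk.symm).resolve_left (by omega))
    simp only [if_pos h1, if_neg h2]
    simp
  · rw [if_neg hy]
    by_cases hvy : v ≤ y
    · have : (∃ k : ℕ, y = (k + 1) • v) ↔ ∃ k : ℕ, y - v = (k + 1) • v := by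
        constructor
        · rintro ⟨_ | k, rfl⟩
          · simp at hy
          · exact ⟨k, by rw [succ_nsmul, add_tsub_cancel_right]⟩
        · rintro ⟨k, hk⟩
          exact ⟨k + 1, by rw [succ_nsmul, ← hk, tsub_add_cancel_of_le hvy]⟩
      rw [if_pos hvy]
      simp only [this, sub_self]
    · have : ¬ ∃ k : ℕ, y = (k + 1) • v := by
        rintro ⟨k, rfl⟩
        exact hvy (by rw [succ_nsmul]; exact le_add_self)
      rw [if_neg hvy, if_neg this, sub_zero]

lemma one_sub_monomial_ne_zero {v : σ →₀ ℕ} (hv : v ≠ 0) :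
    (1 - monomial v (1 : ℝ) : MvPowerSeries σ ℝ) ≠ 0 := by
  classical
  intro h
  have := congrArg (coeff (0 : σ →₀ ℕ)) h
  rw [map_sub, coeff_monomial, if_neg (Ne.symm hv)] at this
  simp at this

lemma openRay_mul_openRay {v w : σ →₀ ℕ} (hv : v ≠ 0) (hw : w ≠ 0) :
    openRay v * openRay w =
      openRay v * openRay (v + w) + openRay (v + w) + openRay w * openRay (v + w) := by
  have hvw : v + w ≠ 0 := fun h => hv (add_eq_zero.1 h).1
  have h1 := one_sub_monomial_mul_openRay hv
  have h2 := one_sub_monomial_mul_openRay hw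
  have h3 := one_sub_monomial_mul_openRay hvw
  have n1 := one_sub_monomial_ne_zero hv
  have n2 := one_sub_monomial_ne_zero hw
  have n3 := one_sub_monomial_ne_zero hvw
  have hm : monomial (v + w) (1 : ℝ) = monomial v 1 * monomial w 1 := by
    rw [monomial_mul_monomial, one_mul]
  rw [hm] at h3 n3
  generalize monomial v (1 : ℝ) = a at *
  generalize monomial w (1 : ℝ) = b at *
  generalize openRay v = A at *
  generalize openRay w = B at *
  generalize openRay (v + w) = D at *
  refine mul_left_cancel₀ (mul_ne_zero (mul_ne_zero n1 n2) n3) ?_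
  calc (1 - a) * (1 - b) * (1 - a * b) * (A * B)
      = ((1 - a) * A) * ((1 - b) * B) * (1 - a * b) := by ring
    _ = a * b * (1 - a * b) := by rw [h1, h2]
    _ = a * (1 - b) * (a * b) + (1 - a) * (1 - b) * (a * b) + (1 - a) * b * (a * b) := by ring
    _ = ((1 - a) * A) * (1 - b) * ((1 - a * b) * D) +
        (1 - a) * (1 - b) * ((1 - a * b) * D) +
        (1 - a) * ((1 - b) * B) * ((1 - a * b) * D) := by rw [h1, h2, h3]
    _ = _ := by ring

/-- The generating series of the positive integral combinations of the vectors in `V`, counted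
with multiplicity. -/
noncomputable def openCone (V : Multiset (σ →₀ ℕ)) : MvPowerSeries σ ℝ :=
  (V.map openRay).prod

lemma openCone_cons (v : σ →₀ ℕ) (V : Multiset (σ →₀ ℕ)) :
    openCone (v ::ₘ V) = openRay v * openCone V := by
  simp [openCone]

lemma exists_of_coeff_openCone_cons_ne_zero {v y : σ →₀ ℕ} {V : Multiset (σ →₀ ℕ)}
    (h : coeff y (openCone (v ::ₘ V)) ≠ 0) :
    ∃ (k : ℕ) (z : σ →₀ ℕ), y = (k + 1) • v + z ∧ coeff z (openCone V) ≠ 0 := by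
  classical
  rw [openCone_cons, coeff_mul] at h
  obtain ⟨⟨a, z⟩, haz, h⟩ := Finset.exists_ne_zero_of_sum_ne_zero h
  rw [Finset.HasAntidiagonal.mem_antidiagonal] at haz
  have ha := left_ne_zero_of_mul h
  rw [coeff_openRay] at ha
  obtain ⟨k, hk⟩ : ∃ k : ℕ, a = (k + 1) • v := by
    by_contra hc
    exact ha (if_neg hc)
  exact ⟨k, z, by rw [← hk]; exact haz.symm, right_ne_zero_of_mul h⟩

lemma nonneg_of_coeff_openCone_ne_zero {l : (σ →₀ ℕ) →+ ℤ} {V : Multiset (σ →₀ ℕ)}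
    (hV : ∀ v ∈ V, 0 ≤ l v) {y : σ →₀ ℕ} (h : coeff y (openCone V) ≠ 0) : 0 ≤ l y := by
  classical
  induction V using Multiset.induction generalizing y with
  | empty =>
    have : y = 0 := by
      by_contra hy
      exact h (by simp [openCone, coeff_one, hy])
    simp [this]
  | cons v V ih =>
    obtain ⟨k, z, rfl, hz⟩ := exists_of_coeff_openCone_cons_ne_zero h
    have h1 := ih (fun v hv => hV v (by simp [hv])) hz
    have h2 := hV v (by simp)
    rw [map_add, map_nsmul]
    positivity

lemma neg_of_coeff_openCone_ne_zero {l : (σ →₀ ℕ) →+ ℤ} {V : Multiset (σ →₀ ℕ)}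
    (hV : ∀ v ∈ V, l v ≤ 0) {w : σ →₀ ℕ} (hw : w ∈ V) (hlw : l w < 0) {y : σ →₀ ℕ}
    (h : coeff y (openCone V) ≠ 0) : l y < 0 := by
  obtain ⟨W, rfl⟩ := Multiset.exists_cons_of_mem hw
  obtain ⟨k, z, rfl, hz⟩ := exists_of_coeff_openCone_cons_ne_zero h
  have h1 := nonneg_of_coeff_openCone_ne_zero (l := -l)
    (fun v hv => by simpa using hV v (by simp [hv])) hz
  rw [AddMonoidHom.neg_apply] at h1
  rw [map_add, map_nsmul, nsmul_eq_mul]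
  have : (((k + 1 : ℕ) : ℤ)) * l w < 0 := mul_neg_of_pos_of_neg (by positivity) hlw
  omega

open Classical in
lemma coeff_openCone_single (s : Finset σ) (y : σ →₀ ℕ) :
    coeff y (openCone (s.val.map fun i => Finsupp.single i 1)) =
      if y.support = s then 1 else 0 := by
  induction s using Finset.induction_on generalizing y with
  | empty => simp [openCone, coeff_one]
  | insert i s hi ih =>
    rw [Finset.insert_val_of_notMem hi, Multiset.map_cons, openCone_cons, coeff_mul]
    have key : ∀ ab ∈ Finset.HasAntidiagonal.antidiagonal y,
        coeff ab.1 (openRay (Finsupp.single i 1)) *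
        coeff ab.2 (openCone (s.val.map fun i => Finsupp.single i 1)) ≠ 0 →
        y.support = insert i s ∧ ab = (Finsupp.single i (y i), y.erase i) := by
      rintro ⟨a, b⟩ hab h
      rw [Finset.HasAntidiagonal.mem_antidiagonal] at hab
      simp only at hab h
      subst hab
      have ha := left_ne_zero_of_mul h
      have hb := right_ne_zero_of_mul h
      rw [coeff_openRay] at ha
      rw [ih] at hb
      obtain ⟨k, rfl⟩ : ∃ k : ℕ, a = (k + 1) • Finsupp.single i 1 := by
        by_contra hc
        exact ha (if_neg hc)
      have hbs : b.support = s := by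
        by_contra hc
        exact hb (if_neg hc)
      subst hbs
      have hbi : b i = 0 := by simpa using hi
      refine ⟨?_, Prod.ext ?_ ?_⟩
      · ext j
        by_cases hj : j = i
        · subst hj; simp
        · simp [hj]
      · ext j
        by_cases hj : j = i
        · subst hj; simp [hbi]
        · simp [Ne.symm hj]
      · ext j
        by_cases hj : j = i
        · subst hj; simp [hbi]
        · simp [hj]
    split_ifs with hy
    · rw [Finset.sum_eq_single (Finsupp.single i (y i), y.erase i)]
      · have hyi : y i ≠ 0 := by rw [← Finsupp.mem_support_iff, hy]; simp
        have h1 : ∃ k : ℕ, Finsupp.single i (y i) = (k + 1) • Finsupp.single i 1 :=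
          ⟨y i - 1, by rw [Nat.sub_add_cancel (by omega)]; simp⟩
        rw [coeff_openRay, if_pos h1, ih, if_pos, one_mul]
        rw [Finsupp.support_erase, hy, Finset.erase_insert hi]
      · intro ab hab hne
        by_contra h
        exact hne (key ab hab h).2
      · intro h
        exact absurd (Finset.HasAntidiagonal.mem_antidiagonal.2 (Finsupp.single_add_erase i y)) h
    · refine Finset.sum_eq_zero fun ab hab => ?_
      by_contra h
      exact hy (key ab hab h).1

variable [Fintype σ]

open Classical in
/-- The sum of the coefficients of `F` in degree `n`, weighted by `ψ`. -/
noncomputable def weightedSum (ψ : (σ →₀ ℕ) → ℝ) (F : MvPowerSeries σ ℝ) (n : ℕ) : ℝ :=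
  ∑ y ∈ Finset.univ.finsuppAntidiag n, ψ y * coeff y F

lemma weightedSum_add (ψ : (σ →₀ ℕ) → ℝ) (F G : MvPowerSeries σ ℝ) (n : ℕ) :
    weightedSum ψ (F + G) n = weightedSum ψ F n + weightedSum ψ G n := by
  simp [weightedSum, mul_add, Finset.sum_add_distrib]

lemma weightedSum_sum {ι : Type*} (s : Finset ι) (ψ : (σ →₀ ℕ) → ℝ)
    (F : ι → MvPowerSeries σ ℝ) (n : ℕ) :
    weightedSum ψ (∑ i ∈ s, F i) n = ∑ i ∈ s, weightedSum ψ (F i) n := by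
  simp only [weightedSum, map_sum, Finset.mul_sum]
  exact Finset.sum_comm

lemma weightedSum_monomial_mul (ψ : (σ →₀ ℕ) → ℝ) (F : MvPowerSeries σ ℝ) (u : σ →₀ ℕ) (n : ℕ) :
    weightedSum ψ (monomial u 1 * F) (n + u.degree) = weightedSum (fun y => ψ (y + u)) F n := by
  classical
  unfold weightedSum
  symm
  refine Finset.sum_of_injOn (fun y => y + u) (add_left_injective u).injOn ?_ ?_ ?_
  · intro y hy
    simp only [Finset.mem_coe, Finset.mem_finsuppAntidiag] at hy ⊢
    simp [Finset.sum_add_distrib, hy.1, Finsupp.degree_eq_sum]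
  · intro y hy hyn
    rw [coeff_monomial_mul]
    split_ifs with huy
    · refine absurd ⟨y - u, ?_, tsub_add_cancel_of_le huy⟩ hyn
      simp only [Finset.mem_coe, Finset.mem_finsuppAntidiag, Finset.subset_univ, and_true] at hy ⊢
      have : ∑ i, (y - u) i + ∑ i, u i = ∑ i, y i := by
        rw [← Finset.sum_add_distrib]
        refine Finset.sum_congr rfl fun i _ => ?_
        rw [← Finsupp.add_apply, tsub_add_cancel_of_le huy]
      rw [hy, Finsupp.degree_eq_sum] at this
      exact Nat.add_right_cancel this
    · simp
  · intro y _
    simp only [add_comm y u, coeff_add_monomial_mul, one_mul]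

lemma isQuasiPoly_weightedSum_openCone {p : ℕ} (hp : 0 < p) (V : Multiset (σ →₀ ℕ))
    (hV : ∀ v ∈ V, v ≠ 0) (χ : (σ →₀ ℕ) → ℝ) (hχ : ∀ y u, χ (y + p • u) = χ y) :
    IsQuasiPoly (weightedSum χ (openCone V)) := by
  classical
  induction V using Multiset.induction generalizing χ with
  | empty =>
    refine IsQuasiPoly.zero.congr fun n hn => ?_
    refine Finset.sum_eq_zero fun y hy => ?_
    have hy0 : y ≠ 0 := by
      rintro rfl
      simp at hy
      omega
    simp [openCone, coeff_one, hy0]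
  | cons v V ih =>
    have hv : v ≠ 0 := hV v (by simp)
    have hdeg : 0 < v.degree := by
      rw [Nat.pos_iff_ne_zero, Ne, Finsupp.degree_eq_zero_iff]
      exact hv
    have hpow : ∀ k : ℕ, (monomial v (1 : ℝ)) ^ k = monomial (k • v) 1 := fun k => by
      rw [monomial_pow, one_pow]
    have hrec : openCone (v ::ₘ V) = monomial (p • v) 1 * openCone (v ::ₘ V) +
        ∑ s ∈ Finset.range p, monomial ((s + 1) • v) 1 * openCone V := by
      have h1 := one_sub_monomial_mul_openRay hv
      have h2 := mul_neg_geom_sum (monomial v (1 : ℝ)) p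
      rw [← Finset.sum_mul]
      simp only [← hpow, pow_succ', ← Finset.mul_sum]
      rw [openCone_cons]
      linear_combination (-openRay v * openCone V) * h2 +
        (∑ s ∈ Finset.range p, monomial v (1 : ℝ) ^ s) * openCone V * h1
    refine IsQuasiPoly.of_difference (a := (p • v).degree)
      (q := fun n => ∑ s ∈ Finset.range p, weightedSum (fun y => χ (y + (s + 1) • v)) (openCone V)
        (n + (p - (s + 1)) * v.degree)) ?_ (by simp [hp, hdeg]) ?_
    · refine IsQuasiPoly.sum _ fun s _ => IsQuasiPoly.shift ?_ _
      refine ih (fun v hv => hV v (by simp [hv])) _ fun y u => ?_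
      rw [add_right_comm, hχ]
    · intro n _
      conv_lhs => rw [hrec]
      rw [weightedSum_add, weightedSum_monomial_mul, weightedSum_sum]
      simp only [hχ]
      congr 1
      refine Finset.sum_congr rfl fun s hs => ?_
      rw [← weightedSum_monomial_mul]
      congr 1
      have : p = (p - (s + 1)) + (s + 1) := by
        have := Finset.mem_range.1 hs
        omega
      conv_lhs => rw [this]
      simp only [map_nsmul, smul_eq_mul]
      ring

open Classical in
lemma isQuasiPoly_weightedSum_openCone_ite {p : ℕ} (hp : 0 < p) (χ : (σ →₀ ℕ) → ℝ)
    (hχ : ∀ y u, χ (y + p • u) = χ y) (L : List ((σ →₀ ℕ) →+ ℤ)) (V : Multiset (σ →₀ ℕ))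
    (hV : ∀ v ∈ V, v ≠ 0) :
    IsQuasiPoly (weightedSum (fun y => if ∀ l ∈ L, 0 ≤ l y then χ y else 0) (openCone V)) := by
  induction L generalizing V with
  | nil => simpa using isQuasiPoly_weightedSum_openCone hp V hV χ hχ
  | cons l L ih =>
    have hnonneg : ∀ V : Multiset (σ →₀ ℕ), (∀ v ∈ V, 0 ≤ l v) → (∀ v ∈ V, v ≠ 0) →
        IsQuasiPoly (weightedSum (fun y => if ∀ l' ∈ l :: L, 0 ≤ l' y then χ y else 0)
          (openCone V)) := by
      intro V hl hV
      refine (ih V hV).congr fun n _ => Finset.sum_congr rfl fun y _ => ?_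
      by_cases h : coeff y (openCone V) = 0
      · simp [h]
      · simp [nonneg_of_coeff_openCone_ne_zero hl h]
    revert hV
    refine elliott_induction (Q := fun V => (∀ v ∈ V, v ≠ 0) → IsQuasiPoly (weightedSum
      (fun y => if ∀ l' ∈ l :: L, 0 ≤ l' y then χ y else 0) (openCone V))) ?_ l hnonneg ?_ V
    · intro v w V h1 h2 h3 hV
      have hv : v ≠ 0 := hV v (by simp)
      have hw : w ≠ 0 := hV w (by simp)
      have hvw : v + w ≠ 0 := fun h => hv (add_eq_zero.1 h).1
      have hV' : ∀ u ∈ V, u ≠ 0 := fun u hu => hV u (by simp [hu])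
      have hsplit : openCone (v ::ₘ w ::ₘ V) = openCone (v ::ₘ (v + w) ::ₘ V) +
          openCone ((v + w) ::ₘ V) + openCone (w ::ₘ (v + w) ::ₘ V) := by
        simp only [openCone_cons]
        linear_combination openCone V * openRay_mul_openRay hv hw
      have e1 := h1 (by simpa [hv, hvw] using hV')
      have e2 := h2 (by simpa [hvw] using hV')
      have e3 := h3 (by simpa [hw, hvw] using hV')
      refine ((e1.add e2).add e3).congr fun n _ => ?_
      rw [hsplit, weightedSum_add, weightedSum_add]
    · intro V hl hV
      by_cases hneg : ∃ w ∈ V, l w < 0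
      · obtain ⟨w, hw, hlw⟩ := hneg
        refine IsQuasiPoly.zero.congr fun n _ => Finset.sum_eq_zero fun y _ => ?_
        by_cases h : coeff y (openCone V) = 0
        · simp [h]
        · have := neg_of_coeff_openCone_ne_zero hl hw hlw h
          have hc : ¬ ∀ l' ∈ l :: L, 0 ≤ l' y := fun hc => by
            have := hc l (by simp)
            omega
          simp only [if_neg hc, zero_mul]
      · push Not at hneg
        exact hnonneg V hneg hV

end Elliott

section Kunz

variable {p : ℕ}

/-- `y` is the function sending a residue class modulo `p` to the least element in this class of
some numerical semigroup containing `p`. -/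
def IsKunz (y : ZMod p → ℕ) : Prop :=
  y 0 = 0 ∧ (∀ i, (y i : ZMod p) = i) ∧ ∀ i j, y (i + j) ≤ y i + y j

/-- The numerical semigroup with minimal elements `y` in the residue classes modulo `p`. -/
def kunzSemigroup (y : ZMod p → ℕ) : Set ℕ := {n | y n ≤ n}

lemma kunzSemigroup_injOn : Set.InjOn (kunzSemigroup (p := p)) {y | IsKunz y} := by
  have key : ∀ y y' : ZMod p → ℕ, IsKunz y → kunzSemigroup y = kunzSemigroup y' →
      ∀ i, y' i ≤ y i := by
    intro y y' hy h i
    have : y i ∈ kunzSemigroup y := by simp [kunzSemigroup, hy.2.1]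
    rw [h] at this
    simpa [kunzSemigroup, hy.2.1] using this
  intro y hy y' hy' h
  exact funext fun i => le_antisymm (key y' y hy' h.symm i) (key y y' hy h i)

variable [NeZero p]

lemma mul_genus_kunzSemigroup {y : ZMod p → ℕ} (hy : IsKunz y) :
    p * genus (kunzSemigroup y) + ∑ i : ZMod p, i.val = ∑ i, y i := by
  classical
  have hp : 0 < p := Nat.pos_of_ne_zero (NeZero.ne p)
  have hle : ∀ i, y i ≤ ∑ i, y i := fun i => Finset.single_le_sum (by simp) (Finset.mem_univ i)
  have hcompl : (kunzSemigroup y)ᶜ =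
      ((Finset.range (∑ i, y i)).filter fun n : ℕ => n < y n : Finset ℕ) := by
    ext n
    simp only [kunzSemigroup, Set.mem_compl_iff, Set.mem_ofPred_eq, not_le, Finset.coe_filter,
      Finset.mem_range]
    exact ⟨fun h => ⟨h.trans_le (hle _), h⟩, fun h => h.2⟩
  have hcard : ((Finset.range (∑ i, y i)).filter fun n : ℕ => n < y n).card =
      ∑ i : ZMod p, y i / p := by
    rw [Finset.card_eq_sum_card_fiberwise (f := fun n : ℕ => (n : ZMod p)) (t := Finset.univ)
      (by simp [Set.MapsTo])]
    refine Finset.sum_congr rfl fun i _ => ?_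
    have h := Nat.count_modEq_card (y i) hp (y i)
    rw [if_neg (lt_irrefl _), add_zero, Nat.count_eq_card_filter_range] at h
    rw [← h]
    congr 1
    ext n
    simp only [Finset.mem_filter, Finset.mem_range]
    rw [← ZMod.natCast_eq_natCast_iff, hy.2.1]
    constructor
    · rintro ⟨⟨_, hn⟩, rfl⟩
      exact ⟨hn, rfl⟩
    · rintro ⟨hn, rfl⟩
      exact ⟨⟨hn.trans_le (hle _), hn⟩, rfl⟩
  rw [genus, hcompl, Set.ncard_coe_finset, hcard, Finset.mul_sum, ← Finset.sum_add_distrib]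
  refine Finset.sum_congr rfl fun i _ => ?_
  have : i.val = y i % p := by rw [← ZMod.val_natCast, hy.2.1]
  rw [this, Nat.div_add_mod]

lemma isNumericalSemigroup_kunzSemigroup {y : ZMod p → ℕ} (hy : IsKunz y) :
    IsNumericalSemigroup (kunzSemigroup y) := by
  refine ⟨by simp [kunzSemigroup, hy.1], fun a ha b hb => ?_, ?_⟩
  · have := hy.2.2 a b
    simp only [kunzSemigroup, Set.mem_ofPred_eq] at *
    push_cast
    omega
  · refine (Set.finite_lt_nat (∑ i, y i)).subset fun n hn => ?_
    have h1 : y n ≤ ∑ i, y i := Finset.single_le_sum (by simp) (Finset.mem_univ _)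
    simp only [kunzSemigroup, Set.mem_compl_iff, Set.mem_ofPred_eq] at *
    omega

lemma exists_kunzSemigroup_eq {H : Set ℕ} (hH : IsNumericalSemigroup H) (hpH : p ∈ H) :
    ∃ y : ZMod p → ℕ, IsKunz y ∧ kunzSemigroup y = H := by
  obtain ⟨h0, hadd, hfin⟩ := hH
  have hp : 0 < p := Nat.pos_of_ne_zero (NeZero.ne p)
  have hne : ∀ i : ZMod p, {n | n ∈ H ∧ (n : ZMod p) = i}.Nonempty := by
    intro i
    obtain ⟨B, hB⟩ := hfin.bddAbove
    refine ⟨i.val + p * (B + 1), ?_, by simp⟩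
    by_contra hc
    have h1 := hB hc
    have h2 : B + 1 ≤ p * (B + 1) := Nat.le_mul_of_pos_left _ hp
    omega
  have hmul : ∀ k n, n ∈ H → n + p * k ∈ H := by
    intro k n hn
    induction k with
    | zero => simpa using hn
    | succ k ih =>
      rw [mul_add, mul_one, ← add_assoc]
      exact hadd _ ih _ hpH
  have hmem := fun i => Nat.sInf_mem (hne i)
  have hle : ∀ n ∈ H, sInf {m | m ∈ H ∧ (m : ZMod p) = n} ≤ n := fun n hn =>
    Nat.sInf_le ⟨hn, rfl⟩
  refine ⟨fun i => sInf {n | n ∈ H ∧ (n : ZMod p) = i}, ⟨?_, fun i => (hmem i).2, fun i j => ?_⟩,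
    ?_⟩
  · simpa using hle 0 h0
  · exact Nat.sInf_le ⟨hadd _ (hmem i).1 _ (hmem j).1, by
      push_cast
      rw [(hmem i).2, (hmem j).2]⟩
  · ext n
    refine ⟨fun hn => ?_, hle n⟩
    have h1 := (hmem (n : ZMod p)).2
    rw [ZMod.natCast_eq_natCast_iff] at h1
    obtain ⟨k, hk⟩ := (Nat.modEq_iff_dvd' hn).1 h1
    dsimp only at hk
    have hn' : sInf {m | m ∈ H ∧ (m : ZMod p) = n} ≤ n := hn
    have : n = sInf {m | m ∈ H ∧ (m : ZMod p) = n} + p * k := by omega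
    rw [this]
    exact hmul _ _ (hmem _).1

lemma countGenus_eq_ncard_isKunz (g : ℕ) :
    countGenus p g =
      {y : ZMod p → ℕ | IsKunz y ∧ ∑ i, y i = p * g + ∑ i : ZMod p, i.val}.ncard := by
  have hp : 0 < p := Nat.pos_of_ne_zero (NeZero.ne p)
  rw [countGenus, ← (kunzSemigroup_injOn.mono fun y hy => hy.1).ncard_image]
  congr 1
  ext H
  constructor
  · rintro ⟨hH, hpH, rfl⟩
    obtain ⟨y, hy, rfl⟩ := exists_kunzSemigroup_eq hH hpH
    exact ⟨y, ⟨hy, (mul_genus_kunzSemigroup hy).symm⟩, rfl⟩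
  · rintro ⟨y, ⟨hy, hsum⟩, rfl⟩
    refine ⟨isNumericalSemigroup_kunzSemigroup hy, by simp [kunzSemigroup, hy.1], ?_⟩
    rw [← mul_genus_kunzSemigroup hy] at hsum
    exact Nat.eq_of_mul_eq_mul_left hp (Nat.add_right_cancel hsum)

lemma countGenus_le (hp : 2 ≤ p) (g : ℕ) :
    countGenus p g ≤ (p * g + ∑ i : ZMod p, i.val + 1) ^ (p - 2) := by
  classical
  rw [countGenus_eq_ncard_isKunz]
  set n := p * g + ∑ i : ZMod p, i.val
  have : Fact (1 < p) := ⟨hp⟩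
  let σ := {i : ZMod p // i ≠ 0 ∧ i ≠ 1}
  have hσ : Fintype.card σ = p - 2 := by
    have : (Finset.univ.filter fun i : ZMod p => i ≠ 0 ∧ i ≠ 1) = {0, 1}ᶜ := by
      ext i; simp
    rw [Fintype.card_subtype, this, Finset.card_compl, Finset.card_pair zero_ne_one, ZMod.card]
  let T : Finset (σ → ℕ) := Fintype.piFinset fun _ => Finset.range (n + 1)
  have hT : T.card = (n + 1) ^ (p - 2) := by
    simp [T, Fintype.card_piFinset, hσ]
  rw [← hT, ← Set.ncard_coe_finset]
  refine Set.ncard_le_ncard_of_injOn (fun y i => y i.1) ?_ ?_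
  · rintro y ⟨_, hy⟩
    simp only [T, Finset.mem_coe, Fintype.mem_piFinset, Finset.mem_range]
    intro i
    have : y i.1 ≤ ∑ i, y i := Finset.single_le_sum (by simp) (Finset.mem_univ _)
    omega
  · rintro y ⟨hy, hys⟩ y' ⟨hy', hys'⟩ h
    have h' : ∀ i, i ≠ 1 → y i = y' i := by
      intro i hi
      by_cases h0 : i = 0
      · rw [h0, hy.1, hy'.1]
      · exact congrFun h ⟨i, h0, hi⟩
    funext i
    by_cases hi : i = 1
    · subst hi
      have e1 := Finset.add_sum_erase Finset.univ y (Finset.mem_univ (1 : ZMod p))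
      have e2 := Finset.add_sum_erase Finset.univ y' (Finset.mem_univ (1 : ZMod p))
      have e3 : ∑ i ∈ Finset.univ.erase 1, y i = ∑ i ∈ Finset.univ.erase 1, y' i :=
        Finset.sum_congr rfl fun i hi => h' i (Finset.ne_of_mem_erase hi)
      omega
    · exact h' i hi

lemma le_countGenus (hp : 2 ≤ p) {t : ℕ} (ht : 0 < t) :
    (t + 1) ^ (p - 2) ≤ countGenus p ((p - 1) * (2 * p * t)) := by
  classical
  rw [countGenus_eq_ncard_isKunz]
  have : Fact (1 < p) := ⟨hp⟩
  let σ := {i : ZMod p // i ≠ 0 ∧ i ≠ 1}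
  have hσ : Fintype.card σ = p - 2 := by
    have : (Finset.univ.filter fun i : ZMod p => i ≠ 0 ∧ i ≠ 1) = {0, 1}ᶜ := by
      ext i; simp
    rw [Fintype.card_subtype, this, Finset.card_compl, Finset.card_pair zero_ne_one, ZMod.card]
  let T : Finset (σ → ℕ) := Fintype.piFinset fun _ => Finset.range (t + 1)
  have hT : T.card = (t + 1) ^ (p - 2) := by
    simp [T, Fintype.card_piFinset, hσ]
  set M := 2 * p * t with hM
  let x : (σ → ℕ) → ZMod p → ℕ := fun z i =>
    if h : i ≠ 0 ∧ i ≠ 1 then M + z ⟨i, h⟩ else if i = 1 then M - ∑ j, z j else 0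
  let y : (σ → ℕ) → ZMod p → ℕ := fun z i => p * x z i + i.val
  have hzle : ∀ z ∈ T, ∀ i, z i ≤ t := fun z hz i =>
    Nat.lt_succ_iff.1 (Finset.mem_range.1 (Fintype.mem_piFinset.1 hz i))
  have hzs : ∀ z ∈ T, ∑ j, z j ≤ (p - 2) * t := fun z hz => by
    refine (Finset.sum_le_sum fun i _ => hzle z hz i).trans ?_
    simp [hσ]
  have hMt : (p - 2) * t + t + 2 * ((p - 2) * t) + 1 ≤ M + (p - 2) * t := by
    obtain ⟨q, rfl⟩ := Nat.exists_eq_add_of_le hp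
    simp only [hM, Nat.add_sub_cancel_left]
    nlinarith
  rw [← hT, ← Set.ncard_coe_finset]
  refine Set.ncard_le_ncard_of_injOn y ?_ ?_ ?_
  · intro z hz
    have hz1 := hzle z hz
    have hz2 := hzs z hz
    have hxl : ∀ i, i ≠ 0 → M ≤ x z i + (p - 2) * t := by
      intro i hi
      simp only [x]
      split_ifs with h1 h2
      · omega
      · omega
      · exact absurd ⟨hi, h2⟩ h1
    have hxu : ∀ i, x z i ≤ M + t := by
      intro i
      simp only [x]
      split_ifs with h1 h2
      · have := hz1 ⟨i, h1⟩
        omega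
      · omega
      · omega
    have hx0 : x z 0 = 0 := by simp [x]
    refine ⟨⟨by simp [y, hx0], fun i => by simp [y], fun i j => ?_⟩, ?_⟩
    · by_cases hi : i = 0
      · simp [hi, y]
      by_cases hj : j = 0
      · simp [hj, y]
      have h1 := hxl i hi
      have h2 := hxl j hj
      have h3 := hxu (i + j)
      have h4 : x z (i + j) + 1 ≤ x z i + x z j := by
        omega
      have h5 := Nat.mul_le_mul_left p h4
      have h6 := ZMod.val_lt (i + j)
      simp only [y]
      rw [mul_add, mul_add, mul_one] at h5
      omega
    · have hxsum : ∑ i, x z i = (p - 1) * M := by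
        rw [← Finset.add_sum_erase Finset.univ _ (Finset.mem_univ (0 : ZMod p)), hx0, zero_add,
          ← Finset.add_sum_erase _ _ (Finset.mem_erase.2
            ⟨one_ne_zero, Finset.mem_univ (1 : ZMod p)⟩)]
        have e : ∑ i ∈ (Finset.univ.erase (0 : ZMod p)).erase 1, x z i = ∑ j : σ, (M + z j) := by
          symm
          refine Finset.sum_of_injOn Subtype.val Subtype.val_injective.injOn ?_ ?_ ?_
          · rintro ⟨i, hi⟩ _
            simp [hi.1, hi.2]
          · intro i hi hni
            simp only [Finset.mem_erase, Finset.mem_univ, and_true] at hi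
            exact absurd ⟨⟨i, hi.2, hi.1⟩, by simp, rfl⟩ hni
          · rintro ⟨i, hi⟩ _
            simp [x, hi]
        have e1 : x z 1 = M - ∑ j, z j := by simp [x]
        rw [e, e1, Finset.sum_add_distrib, Finset.sum_const, Finset.card_univ, hσ, smul_eq_mul]
        have : p - 1 = (p - 2) + 1 := by omega
        rw [this, add_mul]
        omega
      simp only [y]
      rw [Finset.sum_add_distrib, ← Finset.mul_sum, hxsum]
  · intro z _ z' _ h
    funext i
    have h1 := congrFun h i.1
    have hp0 : 0 < p := by omega
    simp only [y] at h1
    have h2 := Nat.eq_of_mul_eq_mul_left hp0 (Nat.add_right_cancel h1)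
    simpa [x, i.2] using h2
  · refine Set.Finite.subset (Fintype.piFinset fun _ : ZMod p => Finset.range
      (p * ((p - 1) * M) + ∑ i : ZMod p, i.val + 1)).finite_toSet ?_
    rintro y ⟨_, hy⟩
    simp only [Finset.mem_coe, Fintype.mem_piFinset, Finset.mem_range]
    intro i
    have : y i ≤ ∑ i, y i := Finset.single_le_sum (by simp) (Finset.mem_univ _)
    omega

end Kunz

/-- The linear forms `y i + y j - y (i + j)`. -/
noncomputable def kunzForms (p : ℕ) [NeZero p] : List ((ZMod p →₀ ℕ) →+ ℤ) :=
  (Finset.univ : Finset (ZMod p × ZMod p)).toList.map fun ij =>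
    (Nat.castAddMonoidHom ℤ).comp (Finsupp.applyAddHom ij.1) +
    (Nat.castAddMonoidHom ℤ).comp (Finsupp.applyAddHom ij.2) -
    (Nat.castAddMonoidHom ℤ).comp (Finsupp.applyAddHom (ij.1 + ij.2))

open Classical in
lemma ncard_isKunz_eq_weightedSum {p : ℕ} [NeZero p] (n : ℕ) :
    ({y : ZMod p → ℕ | IsKunz y ∧ ∑ i, y i = n}.ncard : ℝ) =
      weightedSum (fun y : ZMod p →₀ ℕ =>
        if ∀ l ∈ kunzForms p, 0 ≤ l y
        then (if ∀ i, (y i : ZMod p) = i then 1 else 0) else 0)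
        (openCone ((Finset.univ.erase (0 : ZMod p)).val.map fun i => Finsupp.single i 1)) n := by
  symm
  refine (Finset.sum_congr rfl
    (g := fun y : ZMod p →₀ ℕ => if IsKunz (p := p) y then (1 : ℝ) else 0) fun y _ => ?_).trans ?_
  · dsimp only
    rw [coeff_openCone_single, mul_ite, mul_one, mul_zero, ← ite_and, ← ite_and]
    congr 1
    simp only [kunzForms, List.mem_map, Finset.mem_toList, Finset.mem_univ, true_and, Prod.exists,
      forall_exists_index, eq_iff_iff, IsKunz]
    constructor
    · rintro ⟨⟨h3, h1⟩, h2⟩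
      refine ⟨?_, h2, fun i j => ?_⟩
      · rw [← Finsupp.notMem_support_iff, h3]
        simp
      · have := h1 _ i j rfl
        simp at this
        omega
    · rintro ⟨h0, h1, h2⟩
      refine ⟨⟨?_, ?_⟩, h1⟩
      · ext i
        simp only [Finsupp.mem_support_iff, Finset.mem_erase, Finset.mem_univ, and_true]
        refine not_congr ⟨fun h => ?_, fun h => by rw [h, h0]⟩
        rw [← h1 i, h, Nat.cast_zero]
      · rintro _ i j rfl
        have := h2 i j
        simp
        omega
  rw [Finset.sum_boole, ← Set.ncard_coe_finset]
  congr 1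
  rw [← Set.ncard_image_of_injective _ Finsupp.equivFunOnFinite.injective]
  congr 1
  ext y
  simp only [Set.mem_ofPred_eq, Finset.coe_filter, Finset.mem_finsuppAntidiag,
    Finset.subset_univ, and_true, Set.mem_image]
  constructor
  · rintro ⟨z, ⟨h1, h2⟩, rfl⟩
    exact ⟨h2, h1⟩
  · rintro ⟨h1, h2⟩
    exact ⟨Finsupp.equivFunOnFinite.symm y, by simpa using ⟨h2, h1⟩, by simp⟩

lemma exists_eval_eq_countGenus {p : ℕ} (hp : 2 ≤ p) :
    ∃ N : ℕ, 0 < N ∧ ∀ r : ℕ, ∃ P : Polynomial ℝ,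
      ∀ k : ℕ, (countGenus p (r + N * k) : ℝ) = P.eval (k : ℝ) := by
  classical
  have hp0 : 0 < p := by omega
  have : NeZero p := ⟨hp0.ne'⟩
  have : Fact (1 < p) := ⟨hp⟩
  have hpos : 0 < ∑ i : ZMod p, i.val := by
    have h1 : (1 : ZMod p).val ≤ ∑ i : ZMod p, i.val :=
      Finset.single_le_sum (by simp) (Finset.mem_univ _)
    rw [ZMod.val_one] at h1
    exact h1
  obtain ⟨N, hN, H⟩ := isQuasiPoly_weightedSum_openCone_ite hp0
    (fun y : ZMod p →₀ ℕ => if ∀ i, (y i : ZMod p) = i then 1 else 0) (by simp)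
    (kunzForms p)
    ((Finset.univ.erase (0 : ZMod p)).val.map fun i => Finsupp.single i 1) (by simp)
  refine ⟨N, hN, fun r => ?_⟩
  obtain ⟨P, hP⟩ := H (p * r + ∑ i : ZMod p, i.val) (by omega)
  refine ⟨P.comp (Polynomial.C (p : ℝ) * Polynomial.X), fun k => ?_⟩
  have h := hP (p * k)
  rw [countGenus_eq_ncard_isKunz, ncard_isKunz_eq_weightedSum, Polynomial.eval_comp,
    Polynomial.eval_mul, Polynomial.eval_C, Polynomial.eval_X]
  rw [Nat.cast_mul] at h
  rw [← h]
  congr 1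
  ring

section Growth

open Polynomial Filter

lemma degree_le_of_eval_natCast_le {P Q : ℝ[X]} (hQ : Q ≠ 0)
    (h0 : ∀ k : ℕ, 0 ≤ P.eval (k : ℝ)) (h : ∀ k : ℕ, P.eval (k : ℝ) ≤ Q.eval (k : ℝ)) :
    P.degree ≤ Q.degree := by
  by_contra! hlt
  have h1 := ((abs_div_tendsto_atTop_atTop_of_degree_gt P Q hlt hQ).comp
    (tendsto_natCast_atTop_atTop (R := ℝ))).eventually_gt_atTop 1
  obtain ⟨k, hk⟩ := h1.exists
  simp only [Function.comp_apply, abs_div, abs_of_nonneg (h0 k),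
    abs_of_nonneg ((h0 k).trans (h k))] at hk
  exact absurd hk (not_lt.2 (div_le_one_of_le₀ (h k) ((h0 k).trans (h k))))

lemma leadingCoeff_nonneg_of_eval_natCast_nonneg {P : ℝ[X]}
    (h0 : ∀ k : ℕ, 0 ≤ P.eval (k : ℝ)) : 0 ≤ P.leadingCoeff := by
  by_contra! hlt
  by_cases hd : 0 < P.degree
  · have h1 := ((tendsto_atBot_of_leadingCoeff_nonpos P hd hlt.le).comp
      (tendsto_natCast_atTop_atTop (R := ℝ))).eventually_lt_atBot 0
    obtain ⟨k, hk⟩ := h1.exists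
    exact absurd (h0 k) (not_le.2 hk)
  · have h1 := eq_C_of_degree_le_zero (not_lt.1 hd)
    have h2 := h0 0
    rw [h1, eval_C] at h2
    rw [h1, leadingCoeff_C] at hlt
    exact absurd h2 (not_le.2 hlt)

lemma natDegree_comp_linear (P : ℝ[X]) {a b : ℝ} (ha : a ≠ 0) :
    (P.comp (C a * X + C b)).natDegree = P.natDegree := by
  rw [natDegree_comp, natDegree_linear ha, mul_one]

lemma leadingCoeff_comp_linear_nonneg {P : ℝ[X]} (hP : 0 ≤ P.leadingCoeff) {a b : ℝ}
    (ha : 0 < a) : 0 ≤ (P.comp (C a * X + C b)).leadingCoeff := by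
  rw [leadingCoeff_comp (by rw [natDegree_linear ha.ne']; exact one_ne_zero),
    leadingCoeff_linear ha.ne']
  positivity

lemma natDegree_linear_pow {a b : ℝ} (ha : a ≠ 0) (d : ℕ) :
    ((C a * X + C b) ^ d).natDegree = d := by
  rw [natDegree_pow, natDegree_linear ha, mul_one]

lemma linear_pow_ne_zero {a b : ℝ} (ha : a ≠ 0) (d : ℕ) : (C a * X + C b) ^ d ≠ 0 :=
  pow_ne_zero _ fun h => by simpa [h] using natDegree_linear (b := b) ha

lemma natDegree_le_of_eval_eq_countGenus {p : ℕ} (hp : 2 ≤ p) {N r : ℕ} (hN : 0 < N) {P : ℝ[X]}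
    (hP : ∀ k : ℕ, (countGenus p (r + N * k) : ℝ) = P.eval (k : ℝ)) : P.natDegree ≤ p - 2 := by
  have : NeZero p := ⟨by omega⟩
  have ha : ((p * N : ℕ) : ℝ) ≠ 0 := Nat.cast_ne_zero.2 (Nat.mul_pos (by omega) hN).ne'
  rw [← natDegree_linear_pow (b := (p * r + ∑ i : ZMod p, i.val + 1 : ℕ)) ha (p - 2)]
  refine natDegree_le_natDegree (degree_le_of_eval_natCast_le (linear_pow_ne_zero ha _)
    (fun k => by rw [← hP]; positivity) fun k => ?_)
  rw [← hP]
  refine (Nat.cast_le.2 (countGenus_le hp _)).trans (le_of_eq ?_)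
  simp only [eval_pow, eval_add, eval_mul, eval_C, eval_X]
  push_cast
  ring

lemma le_natDegree_of_eval_eq_countGenus {p : ℕ} (hp : 2 ≤ p) {N : ℕ} (hN : 0 < N) {P : ℝ[X]}
    (hP : ∀ k : ℕ, (countGenus p (N * k) : ℝ) = P.eval (k : ℝ)) : p - 2 ≤ P.natDegree := by
  have : NeZero p := ⟨by omega⟩
  have hN' : (N : ℝ) ≠ 0 := Nat.cast_ne_zero.2 hN.ne'
  have ha : (((p - 1) * (2 * p) : ℕ) : ℝ) ≠ 0 :=
    Nat.cast_ne_zero.2 (Nat.mul_pos (by omega) (by omega)).ne'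
  have key : ∀ k : ℕ, ((C (N : ℝ) * X + C (N + 1 : ℝ)) ^ (p - 2)).eval (k : ℝ) ≤
      (P.comp (C (((p - 1) * (2 * p) : ℕ) : ℝ) * X +
        C (((p - 1) * (2 * p) : ℕ) : ℝ))).eval (k : ℝ) := by
    intro k
    have h1 := le_countGenus hp (t := N * (k + 1)) (by positivity)
    have h2 := hP ((p - 1) * (2 * p) * (k + 1))
    have e : N * ((p - 1) * (2 * p) * (k + 1)) = (p - 1) * (2 * p * (N * (k + 1))) := by ring
    rw [e] at h2
    simp only [eval_comp, eval_pow, eval_add, eval_mul, eval_C, eval_X]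
    have e2 : (((p - 1) * (2 * p) : ℕ) : ℝ) * k + (((p - 1) * (2 * p) : ℕ) : ℝ) =
        (((p - 1) * (2 * p) * (k + 1) : ℕ) : ℝ) := by
      push_cast
      ring
    rw [e2, ← h2]
    refine le_trans (le_of_eq ?_) (Nat.cast_le.2 h1)
    push_cast
    ring
  have hpos : ∀ k : ℕ, 0 < ((C (N : ℝ) * X + C (N + 1 : ℝ)) ^ (p - 2)).eval (k : ℝ) := by
    intro k
    simp only [eval_pow, eval_add, eval_mul, eval_C, eval_X]
    positivity
  have hne : P.comp (C (((p - 1) * (2 * p) : ℕ) : ℝ) * X +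
      C (((p - 1) * (2 * p) : ℕ) : ℝ)) ≠ 0 := by
    intro h
    have := (hpos 0).trans_le (key 0)
    rw [h, eval_zero] at this
    exact lt_irrefl _ this
  have h := natDegree_le_natDegree
    (degree_le_of_eval_natCast_le hne (fun k => (hpos k).le) key)
  rwa [natDegree_linear_pow hN', natDegree_comp_linear P ha] at h

end Growth

/-- `g ↦ G(p,g)` is a quasi-polynomial of degree `p - 2` whose constituent
polynomials all have non-negative coefficient of `T^(p-2)`. -/
theorem countGenus_quasiPolynomial (p : ℕ) (hp : 3 ≤ p) :
    ∃ (N : ℕ) (c : ℕ → Polynomial ℝ), 0 < N ∧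
      (∀ i < N, (c i).degree ≤ ((p - 2 : ℕ) : WithBot ℕ)) ∧
      (∃ i < N, (c i).degree = ((p - 2 : ℕ) : WithBot ℕ)) ∧
      (∀ i < N, 0 ≤ (c i).coeff (p - 2)) ∧
      (∀ g : ℕ, (countGenus p g : ℝ) = (c (g % N)).eval (g : ℝ)) := by
  have hp2 : 2 ≤ p := by omega
  obtain ⟨N, hN, H⟩ := exists_eval_eq_countGenus hp2
  choose P hP using H
  have hN' : (0 : ℝ) < (N : ℝ)⁻¹ := inv_pos.2 (Nat.cast_pos.2 hN)
  have hle : ∀ i, (P i).natDegree ≤ p - 2 := fun i =>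
    natDegree_le_of_eval_eq_countGenus hp2 hN (hP i)
  have hge : p - 2 ≤ (P 0).natDegree :=
    le_natDegree_of_eval_eq_countGenus hp2 hN (by simpa using hP 0)
  have hdeg : ∀ i : ℕ, ((P i).comp (Polynomial.C (N : ℝ)⁻¹ * Polynomial.X +
      Polynomial.C (-((N : ℝ)⁻¹ * i)))).natDegree = (P i).natDegree := fun i =>
    natDegree_comp_linear _ hN'.ne'
  refine ⟨N, fun i => (P i).comp (Polynomial.C (N : ℝ)⁻¹ * Polynomial.X +
    Polynomial.C (-((N : ℝ)⁻¹ * i))), hN, fun i _ => ?_, ⟨0, hN, ?_⟩, fun i _ => ?_, fun g => ?_⟩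
  · rw [← Polynomial.natDegree_le_iff_degree_le, hdeg]
    exact hle i
  · rw [Polynomial.degree_eq_iff_natDegree_eq_of_pos (by omega), hdeg]
    exact le_antisymm (hle 0) hge
  · rcases (hle i).lt_or_eq with h | h
    · rw [Polynomial.coeff_eq_zero_of_natDegree_lt (by rwa [hdeg])]
    · rw [← h, ← hdeg, Polynomial.coeff_natDegree]
      refine leadingCoeff_comp_linear_nonneg (leadingCoeff_nonneg_of_eval_natCast_nonneg
        fun k => ?_) hN'
      rw [← hP]
      positivity
  · have h := hP (g % N) (g / N)
    rw [Nat.mod_add_div] at h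
    have hg : (g : ℝ) = (g % N : ℕ) + N * (g / N : ℕ) := by
      exact_mod_cast (Nat.mod_add_div g N).symm
    rw [h, Polynomial.eval_comp]
    congr 1
    simp only [Polynomial.eval_add, Polynomial.eval_mul, Polynomial.eval_C, Polynomial.eval_X]
    rw [hg, ← hg]
    field_simp
    linarith
end

section
/- Let p ≥ 3 be an integer. For g ∈ ℕ let G(p,g) denote the number of numerical semigroups H with p ∈ H and genus g(H) = g, and let G⁰(p,g) denote the number of numerical semigroups H of maximal embedding dimension p (i.e. m(H) = edim(H) = p) with genus g(H) = g. Then for every g ≥ p−1 one has G⁰(p,g) = G(p, g−(p−1)). -/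
/-- The multiplicity: smallest positive element. -/
noncomputable def mult (H : Set ℕ) : ℕ := sInf {n | n ∈ H ∧ 0 < n}

/-- `G⁰ p g`: the number of numerical semigroups of maximal embedding dimension `p`
(i.e. `m(H) = edim(H) = p`) of genus `g`. -/
noncomputable def countGenusMaxEdim (p g : ℕ) : ℕ :=
  {H : Set ℕ | IsNumericalSemigroup H ∧ mult H = p ∧ edim H = p ∧ genus H = g}.ncard

/-- The set `{0} ∪ (p + S)`. -/
def zeroUnionShift (p : ℕ) (S : Set ℕ) : Set ℕ := insert 0 ((· + p) '' S)

theorem compl_image_add_right (p : ℕ) (T : Set ℕ) :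
    ((· + p) '' T)ᶜ = Set.Iio p ∪ (· + p) '' Tᶜ := by
  ext n
  simp only [Set.mem_compl_iff, Set.mem_image, Set.mem_union, Set.mem_Iio, not_exists, not_and]
  constructor
  · intro h
    by_cases hn : n < p
    · exact Or.inl hn
    · exact Or.inr ⟨n - p, fun hT => h _ hT (by omega), by omega⟩
  · rintro (h | ⟨m, hm, rfl⟩) t ht e
    · omega
    · obtain rfl : t = m := by omega
      exact hm ht

theorem finite_compl_image_add_right (p : ℕ) {T : Set ℕ} (hT : Tᶜ.Finite) :
    ((· + p) '' T)ᶜ.Finite := by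
  rw [compl_image_add_right]
  exact (Set.finite_Iio p).union (hT.image _)

theorem ncard_compl_image_add_right (p : ℕ) {T : Set ℕ} (hT : Tᶜ.Finite) :
    ((· + p) '' T)ᶜ.ncard = p + Tᶜ.ncard := by
  rw [compl_image_add_right, Set.ncard_union_eq _ (Set.finite_Iio p) (hT.image _),
    Set.ncard_image_of_injective _ (add_left_injective p)]
  · simp [← Finset.coe_Iio, Set.ncard_coe_finset]
  · rw [Set.disjoint_left]
    rintro n hn ⟨m, -, rfl⟩
    simp at hn

/-- A cofinite set stable under translation by `p` has exactly `p` elements outside its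
translate. -/
theorem ncard_diff_image_add_right (p : ℕ) {T : Set ℕ} (hT : Tᶜ.Finite)
    (hp : ∀ t ∈ T, t + p ∈ T) : (T \ (· + p) '' T).ncard = p := by
  have hsub : (· + p) '' T ⊆ T := by
    rintro _ ⟨t, ht, rfl⟩
    exact hp t ht
  have hdiff : ((· + p) '' T)ᶜ \ Tᶜ = T \ (· + p) '' T := by
    ext n
    simp only [Set.mem_sdiff, Set.mem_compl_iff]
    tauto
  have := Set.ncard_sdiff_add_ncard_of_subset (Set.compl_subset_compl.mpr hsub)
    (finite_compl_image_add_right p hT)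
  rw [hdiff, ncard_compl_image_add_right p hT] at this
  omega

theorem zeroUnionShift_diff_zero {p : ℕ} (hp : 0 < p) (S : Set ℕ) :
    zeroUnionShift p S \ {0} = (· + p) '' S := by
  ext n
  simp only [zeroUnionShift, Set.mem_sdiff, Set.mem_insert_iff, Set.mem_image,
    Set.mem_singleton_iff]
  constructor
  · tauto
  · rintro ⟨s, hs, rfl⟩
    exact ⟨Or.inr ⟨s, hs, rfl⟩, by omega⟩

theorem zeroUnionShift_injective {p : ℕ} (hp : 0 < p) :
    Function.Injective (zeroUnionShift p) := by
  intro S S' h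
  apply (add_left_injective p).image_injective
  simp only [← zeroUnionShift_diff_zero hp, h]

theorem genus_zeroUnionShift {p : ℕ} (hp : 0 < p) {S : Set ℕ} (hS : Sᶜ.Finite) :
    genus (zeroUnionShift p S) + 1 = p + genus S := by
  have h0 : (0 : ℕ) ∈ ((· + p) '' S)ᶜ := by
    rintro ⟨s, -, hs⟩
    simp only at hs
    omega
  have he : (zeroUnionShift p S)ᶜ = ((· + p) '' S)ᶜ \ {0} := by
    ext n
    simp only [zeroUnionShift, Set.mem_compl_iff, Set.mem_insert_iff, Set.mem_sdiff,
      Set.mem_singleton_iff]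
    tauto
  rw [genus, genus, he, Set.ncard_sdiff_singleton_add_one h0 (finite_compl_image_add_right p hS),
    ncard_compl_image_add_right p hS]

theorem IsNumericalSemigroup.zeroUnionShift {p : ℕ} {S : Set ℕ} (hS : IsNumericalSemigroup S)
    (hpS : p ∈ S) : IsNumericalSemigroup (zeroUnionShift p S) := by
  obtain ⟨-, hadd, hfin⟩ := hS
  refine ⟨Or.inl rfl, ?_, (finite_compl_image_add_right p hfin).subset
    (Set.compl_subset_compl.mpr (Set.subset_insert _ _))⟩
  rintro a (rfl | ⟨s, hs, rfl⟩) b hb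
  · rwa [zero_add]
  · rcases hb with rfl | ⟨t, ht, rfl⟩
    · exact Or.inr ⟨s, hs, rfl⟩
    · exact Or.inr ⟨s + t + p, hadd _ (hadd _ hs _ ht) _ hpS, by simp only; ring⟩

theorem mult_zeroUnionShift {p : ℕ} (hp : 0 < p) {S : Set ℕ} (h0 : 0 ∈ S) :
    mult (zeroUnionShift p S) = p := by
  refine IsLeast.csInf_eq ⟨⟨Or.inr ⟨0, h0, zero_add p⟩, hp⟩, ?_⟩
  rintro n ⟨rfl | ⟨s, -, rfl⟩, hn⟩
  · omega
  · exact Nat.le_add_left p s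

theorem edim_zeroUnionShift {p : ℕ} (hp : 0 < p) {S : Set ℕ} (hS : IsNumericalSemigroup S)
    (hpS : p ∈ S) : edim (zeroUnionShift p S) = p := by
  obtain ⟨h0, hadd, hfin⟩ := hS
  have hsum : {n | ∃ a ∈ (· + p) '' S, ∃ b ∈ (· + p) '' S, n = a + b} =
      (· + p) '' ((· + p) '' S) := by
    ext n
    constructor
    · rintro ⟨_, ⟨s, hs, rfl⟩, _, ⟨t, ht, rfl⟩, rfl⟩
      exact ⟨_, ⟨s + t, hadd _ hs _ ht, rfl⟩, by simp only; ring⟩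
    · rintro ⟨_, ⟨s, hs, rfl⟩, rfl⟩
      exact ⟨_, ⟨s, hs, rfl⟩, p, ⟨0, h0, zero_add p⟩, rfl⟩
  rw [edim, zeroUnionShift_diff_zero hp, hsum]
  refine ncard_diff_image_add_right p (finite_compl_image_add_right p hfin) ?_
  rintro _ ⟨s, hs, rfl⟩
  exact ⟨s + p, hadd _ hs _ hpS, rfl⟩

/-- In a numerical semigroup of maximal embedding dimension `p`, every sum of two positive
elements is the sum of `p` and a positive element. -/
theorem IsNumericalSemigroup.exists_add_eq_of_edim_eq {p : ℕ} (hp : 0 < p) {H : Set ℕ}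
    (hH : IsNumericalSemigroup H) (hpH : p ∈ H) (hedim : edim H = p) {a b : ℕ}
    (ha : a ∈ H \ {0}) (hb : b ∈ H \ {0}) : ∃ c ∈ H \ {0}, c + p = a + b := by
  obtain ⟨-, hadd, hfin⟩ := hH
  have hadd' : ∀ x ∈ H \ {0}, ∀ y ∈ H \ {0}, x + y ∈ H \ {0} := by
    rintro x ⟨hx, hx0⟩ y ⟨hy, -⟩
    refine ⟨hadd _ hx _ hy, ?_⟩
    simp only [Set.mem_singleton_iff] at hx0 ⊢
    omega
  have hpT : p ∈ H \ {0} := ⟨hpH, hp.ne'⟩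
  have hTfin : (H \ {0})ᶜ.Finite := by
    rw [Set.compl_sdiff]
    exact (Set.finite_singleton 0).union hfin
  have hcard := ncard_diff_image_add_right p hTfin fun t ht => hadd' t ht p hpT
  have hfin' : ((H \ {0}) \ (· + p) '' (H \ {0})).Finite :=
    Set.finite_of_ncard_pos (by omega)
  have heq := Set.eq_of_subset_of_ncard_le (s := (H \ {0}) \
      {n | ∃ a ∈ H \ {0}, ∃ b ∈ H \ {0}, n = a + b}) (Set.sdiff_subset_sdiff_right (by
    rintro _ ⟨t, ht, rfl⟩
    exact ⟨t, ht, p, hpT, rfl⟩)) (by rw [hcard]; exact hedim.ge) hfin'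
  by_contra hc
  have hmem : a + b ∈ (H \ {0}) \ (· + p) '' (H \ {0}) := ⟨hadd' a ha b hb, hc⟩
  rw [← heq] at hmem
  exact hmem.2 ⟨a, ha, b, hb, rfl⟩

theorem IsNumericalSemigroup.exists_eq_zeroUnionShift {p : ℕ} (hp : 0 < p) {H : Set ℕ}
    (hH : IsNumericalSemigroup H) (hmult : mult H = p) (hedim : edim H = p) :
    ∃ S, IsNumericalSemigroup S ∧ p ∈ S ∧ _root_.zeroUnionShift p S = H := by
  have hpH : p ∈ H := by
    have := Nat.sInf_mem (Nat.nonempty_of_pos_sInf (hmult.symm ▸ hp : 0 < mult H))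
    exact hmult ▸ this.1
  have hle : ∀ n ∈ H, n ≠ 0 → p ≤ n := fun n hn h0 =>
    hmult ▸ Nat.sInf_le ⟨hn, Nat.pos_of_ne_zero h0⟩
  refine ⟨{n | n + p ∈ H}, ⟨?_, ?_, ?_⟩, hH.2.1 _ hpH _ hpH, ?_⟩
  · simpa using hpH
  · intro a ha b hb
    obtain ⟨c, hc, h⟩ := hH.exists_add_eq_of_edim_eq hp hpH hedim
      (a := a + p) (b := b + p) ⟨ha, by simp; omega⟩ ⟨hb, by simp; omega⟩
    obtain rfl : c = a + b + p := by omega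
    exact hc.1
  · exact hH.2.2.preimage (add_left_injective p).injOn
  · ext n
    constructor
    · rintro (rfl | ⟨s, hs, rfl⟩)
      · exact hH.1
      · exact hs
    · intro hn
      by_cases h0 : n = 0
      · exact Or.inl h0
      · have := Nat.sub_add_cancel (hle n hn h0)
        exact Or.inr ⟨n - p, by simpa [this] using hn, this⟩

/-- For `g ≥ p - 1` one has `G⁰(p,g) = G(p, g - (p-1))`. -/
theorem countGenusMaxEdim_eq_countGenus (p : ℕ) (hp : 3 ≤ p) (g : ℕ) (hg : p - 1 ≤ g) :
    countGenusMaxEdim p g = countGenus p (g - (p - 1)) := by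
  have hp0 : 0 < p := by omega
  rw [countGenusMaxEdim, countGenus,
    ← Set.ncard_image_of_injective {H | IsNumericalSemigroup H ∧ p ∈ H ∧ genus H = g - (p - 1)}
      (zeroUnionShift_injective hp0)]
  congr 1
  ext H
  constructor
  · rintro ⟨hH, hmult, hedim, hgenus⟩
    obtain ⟨S, hS, hpS, rfl⟩ := hH.exists_eq_zeroUnionShift hp0 hmult hedim
    have := genus_zeroUnionShift hp0 hS.2.2
    exact ⟨S, ⟨hS, hpS, by omega⟩, rfl⟩
  · rintro ⟨S, ⟨hS, hpS, hgenus⟩, rfl⟩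
    have := genus_zeroUnionShift hp0 hS.2.2
    exact ⟨hS.zeroUnionShift hpS, mult_zeroUnionShift hp0 hS.1, edim_zeroUnionShift hp0 hS hpS,
      by omega⟩
end
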